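/- arXiv:2510.18365 — 3 statements merged into one kernel-verified Lean document; each statement's English description precedes it below -/
import Mathlib

section
/- There exists a universal constant C > 0 such that the following holds. Let ν > 0, k ∈ ℝ with k ≠ 0, and let f : [0,∞) × [−1,1] → ℂ be continuous, with continuous derivatives ∂_t f, ∂_y f, ∂²_y f and ∂_t ∂_y f, satisfying ∂_t f(t,y) = ν(∂²_y f(t,y) − k² f(t,y)) − i k y f(t,y) for all t ≥ 0 and y ∈ (−1,1), and f(t,−1) = f(t,1) = 0 for all t ≥ 0. Then for every t > 0, |k| · ‖f(t,·)‖_{L²(−1,1)} ≤ C (νt)^{−1/2} (1+t)^{−1} ‖f(0,·)‖_{L²(−1,1)}. -/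
open Set

/-- The `L²` norm of a function on the interval `(-1, 1)`. -/
noncomputable def L2norm (h : ℝ → ℂ) : ℝ :=
  Real.sqrt (∫ y in (-1 : ℝ)..1, ‖h y‖ ^ 2)

open MeasureTheory Filter Topology

section ParametricIntegrals

variable {E : Type*} [NormedAddCommGroup E]

theorem continuousOn_slice {g : ℝ → ℝ → E} {a b t : ℝ} (ht : 0 ≤ t)
    (hg : ContinuousOn (fun p : ℝ × ℝ => g p.1 p.2) (Ici 0 ×ˢ Icc a b)) :
    ContinuousOn (g t) (Icc a b) :=
  hg.comp (f := fun y => (t, y)) (by fun_prop) fun _ hy => ⟨ht, hy⟩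

theorem exists_bound_on_strip {g : ℝ → ℝ → E} {a b : ℝ} (T : ℝ)
    (hg : ContinuousOn (fun p : ℝ × ℝ => g p.1 p.2) (Ici 0 ×ˢ Icc a b)) :
    ∃ M, ∀ t ∈ Icc 0 T, ∀ y ∈ Icc a b, ‖g t y‖ ≤ M := by
  obtain ⟨M, hM⟩ := (isCompact_Icc.prod isCompact_Icc).exists_bound_of_continuousOn
    (hg.mono (prod_mono (Icc_subset_Ici_self : Icc 0 T ⊆ Ici 0) subset_rfl))
  exact ⟨M, fun t ht y hy => hM (t, y) ⟨ht, hy⟩⟩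

theorem aestronglyMeasurable_uIoc {g : ℝ → E} {a b : ℝ} (hab : a ≤ b)
    (hg : ContinuousOn g (Icc a b)) :
    AEStronglyMeasurable g (volume.restrict (uIoc a b)) := by
  rw [uIoc_of_le hab]
  exact (hg.mono Ioc_subset_Icc_self).aestronglyMeasurable measurableSet_Ioc

variable [NormedSpace ℝ E]

theorem continuousOn_integral_strip {g : ℝ → ℝ → E} {a b : ℝ} (hab : a ≤ b)
    (hg : ContinuousOn (fun p : ℝ × ℝ => g p.1 p.2) (Ici 0 ×ˢ Icc a b)) :
    ContinuousOn (fun t => ∫ y in a..b, g t y) (Ici 0) := by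
  intro t ht
  obtain ⟨M, hM⟩ := exists_bound_on_strip (t + 1) hg
  refine intervalIntegral.continuousWithinAt_of_dominated_interval (bound := fun _ => M)
    ?_ ?_ intervalIntegrable_const (ae_of_all _ fun y hy => ?_)
  · filter_upwards [self_mem_nhdsWithin] with s hs
    exact aestronglyMeasurable_uIoc hab (continuousOn_slice hs hg)
  · filter_upwards [self_mem_nhdsWithin,
      mem_nhdsWithin_of_mem_nhds (Iic_mem_nhds (lt_add_one t))] with s hs hs'
    refine ae_of_all _ fun y hy => hM s ⟨hs, hs'⟩ y ?_
    exact Ioc_subset_Icc_self (uIoc_of_le hab ▸ hy)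
  · have hy' : y ∈ Icc a b := Ioc_subset_Icc_self (uIoc_of_le hab ▸ hy)
    exact hg.comp (f := fun s => (s, y)) (s := Ici 0) (by fun_prop) (fun s hs => ⟨hs, hy'⟩) t ht

theorem hasDerivAt_integral_strip {g gt : ℝ → ℝ → E} {a b t : ℝ} (hab : a ≤ b) (ht : 0 < t)
    (hg : ContinuousOn (fun p : ℝ × ℝ => g p.1 p.2) (Ici 0 ×ˢ Icc a b))
    (hgt : ContinuousOn (fun p : ℝ × ℝ => gt p.1 p.2) (Ici 0 ×ˢ Icc a b))
    (hderiv : ∀ s ∈ Ici (0 : ℝ), ∀ y ∈ Icc a b, HasDerivAt (fun r => g r y) (gt s y) s) :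
    HasDerivAt (fun s => ∫ y in a..b, g s y) (∫ y in a..b, gt t y) t := by
  obtain ⟨M, hM⟩ := exists_bound_on_strip (t + 1) hgt
  have hsub : uIoc a b ⊆ Icc a b := uIoc_of_le hab ▸ Ioc_subset_Icc_self
  refine (intervalIntegral.hasDerivAt_integral_of_dominated_loc_of_deriv_le
    (bound := fun _ => M) (Icc_mem_nhds ht (lt_add_one t)) ?_
    ((continuousOn_slice ht.le hg).intervalIntegrable_of_Icc hab)
    (aestronglyMeasurable_uIoc hab (continuousOn_slice ht.le hgt))
    (ae_of_all _ fun y hy s hs => hM s hs y (hsub hy)) intervalIntegrable_const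
    (ae_of_all _ fun y hy s hs => hderiv s hs.1 y (hsub hy))).2
  filter_upwards [Ioi_mem_nhds ht] with s hs
  exact aestronglyMeasurable_uIoc hab (continuousOn_slice (le_of_lt hs) hg)

/-- Symmetry of mixed partial derivatives on a strip: if `∂_t ∂_y f` is continuous, then
`∂_y ∂_t f` exists and agrees with it. -/
theorem hasDerivAt_mixed_strip [CompleteSpace E] {f ft fy fty : ℝ → ℝ → E} {a b t y : ℝ}
    (ht : 0 < t) (hy : y ∈ Ioo a b)
    (hfy : ContinuousOn (fun p : ℝ × ℝ => fy p.1 p.2) (Ici 0 ×ˢ Icc a b))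
    (hfty : ContinuousOn (fun p : ℝ × ℝ => fty p.1 p.2) (Ici 0 ×ˢ Icc a b))
    (hdt : ∀ s ∈ Ici (0 : ℝ), ∀ z ∈ Icc a b, HasDerivAt (fun r => f r z) (ft s z) s)
    (hdy : ∀ s ∈ Ici (0 : ℝ), ∀ z ∈ Icc a b, HasDerivAt (fun w => f s w) (fy s z) z)
    (hdty : ∀ s ∈ Ici (0 : ℝ), ∀ z ∈ Icc a b, HasDerivAt (fun r => fy r z) (fty s z) s) :
    HasDerivAt (ft t) (fty t y) y := by
  have hcont := continuousOn_slice ht.le hfty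
  have hformula : ∀ z ∈ Ioo a b, ft t z = (∫ w in a..z, fty t w) + ft t a := by
    intro z hz
    have hsub : Icc a z ⊆ Icc a b := Icc_subset_Icc_right hz.2.le
    have h₁ : HasDerivAt (fun s => ∫ w in a..z, fy s w) (∫ w in a..z, fty t w) t :=
      hasDerivAt_integral_strip hz.1.le ht (hfy.mono (prod_mono subset_rfl hsub))
        (hfty.mono (prod_mono subset_rfl hsub)) fun s hs w hw => hdty s hs w (hsub hw)
    have h₂ : HasDerivAt (fun s => f s z - f s a) (ft t z - ft t a) t :=
      (hdt t ht.le z (Ioo_subset_Icc_self hz)).sub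
        (hdt t ht.le a ⟨le_rfl, (hz.1.trans hz.2).le⟩)
    have h₃ : (fun s => f s z - f s a) =ᶠ[𝓝 t] fun s => ∫ w in a..z, fy s w := by
      filter_upwards [Ioi_mem_nhds ht] with s hs
      have hs' : (0 : ℝ) ≤ s := le_of_lt hs
      refine (intervalIntegral.integral_eq_sub_of_hasDerivAt (fun w hw => ?_) ?_).symm
      · rw [uIcc_of_le hz.1.le] at hw
        exact hdy s hs' w (hsub hw)
      · exact ((continuousOn_slice hs' hfy).mono hsub).intervalIntegrable_of_Icc hz.1.le
    rw [← h₂.unique (h₁.congr_of_eventuallyEq h₃), sub_add_cancel]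
  have hnhds : Icc a b ∈ 𝓝 y := Icc_mem_nhds hy.1 hy.2
  refine HasDerivAt.congr_of_eventuallyEq (f := fun z => (∫ w in a..z, fty t w) + ft t a) ?_
    (by filter_upwards [Ioo_mem_nhds hy.1 hy.2] with z hz using hformula z hz)
  refine (intervalIntegral.integral_hasDerivAt_right ?_ ?_ (hcont.continuousAt hnhds)).add_const _
  · exact (hcont.mono (Icc_subset_Icc_right hy.2.le)).intervalIntegrable_of_Icc hy.1.le
  · exact (hcont.mono Ioo_subset_Icc_self).stronglyMeasurableAtFilter isOpen_Ioo y hy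

end ParametricIntegrals

section Energy

/-- Time-weighted hypocoercive energy density of `p + i q`, with spatial derivative `r + i s`. -/
noncomputable def energyDensity (ν k t p q r s : ℝ) : ℝ :=
  (1 + ν * k ^ 2 * t + ν * k ^ 2 * t ^ 3 / 192) * (p ^ 2 + q ^ 2)
    + 3 / 32 * ν * t * (r ^ 2 + s ^ 2) + ν * t ^ 2 / 32 * k * (p * s - q * r)

/-- Time derivative of `energyDensity`, where a subscript `t` marks a time derivative. -/
noncomputable def energyRate (ν k t p q pt qt r s rt st : ℝ) : ℝ :=
  (ν * k ^ 2 + ν * k ^ 2 * t ^ 2 / 64) * (p ^ 2 + q ^ 2)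
    + (1 + ν * k ^ 2 * t + ν * k ^ 2 * t ^ 3 / 192) * (2 * (p * pt + q * qt))
    + 3 / 32 * ν * (r ^ 2 + s ^ 2) + 3 / 32 * ν * t * (2 * (r * rt + s * st))
    + ν * t / 16 * k * (p * s - q * r)
    + ν * t ^ 2 / 32 * k * (pt * s + p * st - qt * r - q * rt)

/-- Dissipation density, where `u + i v` is the second spatial derivative. -/
noncomputable def dissipation (ν k t p q r s u v : ℝ) : ℝ :=
  (1 + ν * k ^ 2 * t + ν * k ^ 2 * t ^ 3 / 192)
      * (2 * ν * (r ^ 2 + s ^ 2) + 2 * ν * k ^ 2 * (p ^ 2 + q ^ 2))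
    - (ν * k ^ 2 + ν * k ^ 2 * t ^ 2 / 64) * (p ^ 2 + q ^ 2)
    - 3 / 32 * ν * (r ^ 2 + s ^ 2)
    + 3 / 32 * ν * t * (2 * ν * (u ^ 2 + v ^ 2) + 2 * ν * k ^ 2 * (r ^ 2 + s ^ 2)
      + 2 * k * (p * s - q * r))
    - ν * t / 16 * k * (p * s - q * r)
    - ν * t ^ 2 / 32 * (2 * ν * k * (u * s - v * r) - 2 * ν * k ^ 3 * (p * s - q * r)
      - k ^ 2 * (p ^ 2 + q ^ 2))

/-- Spatial flux of the energy density. -/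
noncomputable def energyFlux (ν k t y p q pt qt r s : ℝ) : ℝ :=
  (1 + ν * k ^ 2 * t + ν * k ^ 2 * t ^ 3 / 192) * (2 * ν * (p * r + q * s))
    + 3 / 32 * ν * t * (2 * (r * pt + s * qt + ν * k ^ 2 * (p * r + q * s)
      - k * y * (r * q - s * p)))
    + ν * t ^ 2 / 32 * (k * (p * qt - q * pt) + k ^ 2 * y * (p ^ 2 + q ^ 2))

theorem hasDerivAt_energyDensity (ν k : ℝ) {p q r s : ℝ → ℝ} {t pt qt rt st : ℝ}
    (hp : HasDerivAt p pt t) (hq : HasDerivAt q qt t)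
    (hr : HasDerivAt r rt t) (hs : HasDerivAt s st t) :
    HasDerivAt (fun τ => energyDensity ν k τ (p τ) (q τ) (r τ) (s τ))
      (energyRate ν k t (p t) (q t) pt qt (r t) (s t) rt st) t := by
  have ht := hasDerivAt_id t
  have h := ((((ht.const_mul (ν * k ^ 2)).const_add 1).add
    (((ht.pow 3).const_mul (ν * k ^ 2)).div_const 192)).mul ((hp.pow 2).add (hq.pow 2))).add
    ((ht.const_mul (3 / 32 * ν)).mul ((hr.pow 2).add (hs.pow 2))) |>.add
    ((((ht.pow 2).const_mul ν).div_const 32).mul_const k |>.mul ((hp.mul hs).sub (hq.mul hr)))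
  refine (h.congr_deriv ?_).congr_of_eventuallyEq (.of_forall fun τ => ?_)
  · simp only [energyRate, id, Pi.add_apply, Pi.mul_apply, Pi.pow_apply, Pi.sub_apply]
    push_cast
    ring
  · simp only [energyDensity, id, Pi.add_apply, Pi.mul_apply, Pi.pow_apply, Pi.sub_apply]

theorem hasDerivAt_energyFlux (ν k t : ℝ) {p q pt qt r s : ℝ → ℝ} {y rt st u v : ℝ}
    (hp : HasDerivAt p (r y) y) (hq : HasDerivAt q (s y) y)
    (hpt : HasDerivAt pt rt y) (hqt : HasDerivAt qt st y)
    (hr : HasDerivAt r u y) (hs : HasDerivAt s v y)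
    (hpeq : pt y = ν * (u - k ^ 2 * p y) + k * y * q y)
    (hqeq : qt y = ν * (v - k ^ 2 * q y) - k * y * p y) :
    HasDerivAt (fun z => energyFlux ν k t z (p z) (q z) (pt z) (qt z) (r z) (s z))
      (energyRate ν k t (p y) (q y) (pt y) (qt y) (r y) (s y) rt st
        + dissipation ν k t (p y) (q y) (r y) (s y) u v) y := by
  have hy := hasDerivAt_id y
  have hpr := (hp.mul hr).add (hq.mul hs)
  have h := ((hpr.const_mul (2 * ν)).const_mul
      (1 + ν * k ^ 2 * t + ν * k ^ 2 * t ^ 3 / 192)).add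
    (((((hr.mul hpt).add (hs.mul hqt)).add (hpr.const_mul (ν * k ^ 2))).sub
      ((hy.const_mul k).mul ((hr.mul hq).sub (hs.mul hp)))).const_mul 2 |>.const_mul
        (3 / 32 * ν * t)) |>.add
    (((((hp.mul hqt).sub (hq.mul hpt)).const_mul k).add
      ((hy.const_mul (k ^ 2)).mul ((hp.pow 2).add (hq.pow 2)))).const_mul (ν * t ^ 2 / 32))
  refine (h.congr_deriv ?_).congr_of_eventuallyEq (.of_forall fun z => ?_)
  · simp only [energyRate, dissipation, id, Pi.add_apply, Pi.mul_apply, Pi.pow_apply,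
      Pi.sub_apply, hpeq, hqeq]
    push_cast
    ring
  · simp only [energyFlux, id, Pi.add_apply, Pi.mul_apply, Pi.pow_apply, Pi.sub_apply]

theorem dissipation_nonneg {ν t : ℝ} (hν : 0 ≤ ν) (ht : 0 ≤ t) (k p q r s u v : ℝ) :
    0 ≤ dissipation ν k t p q r s u v := by
  have h₁ : 0 ≤ ν * ((s + t * k * p / 16) ^ 2 + (r - t * k * q / 16) ^ 2) := by positivity
  have h₂ : 0 ≤ ν ^ 2 * t * ((u - t * k * s / 3) ^ 2 + (v + t * k * r / 3) ^ 2) := by positivity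
  have h₃ : 0 ≤ ν ^ 2 * t * k ^ 2 * ((s + t * k * p / 6) ^ 2 + (r - t * k * q / 6) ^ 2) := by
    positivity
  have h₄ : 0 ≤ ν * (r ^ 2 + s ^ 2) := by positivity
  have h₅ : 0 ≤ ν * k ^ 2 * (p ^ 2 + q ^ 2) := by positivity
  have h₆ : 0 ≤ ν * k ^ 2 * t ^ 2 * (p ^ 2 + q ^ 2) := by positivity
  have h₇ : 0 ≤ ν ^ 2 * k ^ 2 * t * (r ^ 2 + s ^ 2) := by positivity
  have h₈ : 0 ≤ ν ^ 2 * k ^ 4 * t * (p ^ 2 + q ^ 2) := by positivity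
  have h₉ : 0 ≤ ν ^ 2 * k ^ 4 * t ^ 3 * (p ^ 2 + q ^ 2) := by positivity
  have h₁₀ : 0 ≤ ν ^ 2 * t * (u ^ 2 + v ^ 2) := by positivity
  have h₁₁ : 0 ≤ ν ^ 2 * k ^ 2 * t ^ 3 * (r ^ 2 + s ^ 2) := by positivity
  unfold dissipation
  linarith

theorem le_energyDensity {ν t : ℝ} (hν : 0 ≤ ν) (ht : 0 ≤ t) (k p q r s : ℝ) :
    ν * k ^ 2 * t * (1 + t) ^ 2 / 768 * (p ^ 2 + q ^ 2) ≤ energyDensity ν k t p q r s := by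
  have h₁ : 0 ≤ ν * t * ((s + t * k * p / 6) ^ 2 + (r - t * k * q / 6) ^ 2) := by positivity
  have h₂ : 0 ≤ ν * k ^ 2 * t * (p ^ 2 + q ^ 2) := by positivity
  have h₃ : 0 ≤ ν * k ^ 2 * t * (1 - t) ^ 2 * (p ^ 2 + q ^ 2) := by positivity
  have h₄ : 0 ≤ p ^ 2 + q ^ 2 := by positivity
  unfold energyDensity
  linarith

end Energy

theorem hasDerivAt_re {g : ℝ → ℂ} {g' : ℂ} {x : ℝ} (h : HasDerivAt g g' x) :
    HasDerivAt (fun z => (g z).re) g'.re x :=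
  Complex.reCLM.hasFDerivAt.comp_hasDerivAt x h

theorem hasDerivAt_im {g : ℝ → ℂ} {g' : ℂ} {x : ℝ} (h : HasDerivAt g g' x) :
    HasDerivAt (fun z => (g z).im) g'.im x :=
  Complex.imCLM.hasFDerivAt.comp_hasDerivAt x h

theorem mul_sqrt_le_of_mul_le {ν k t a b C : ℝ} (hν : 0 < ν) (ht : 0 < t) (hC : 0 ≤ C)
    (h : ν * k ^ 2 * t * (1 + t) ^ 2 * a ≤ C ^ 2 * b) :
    |k| * √a ≤ C * (ν * t) ^ (-(1 : ℝ) / 2) * (1 + t) ^ (-(1 : ℝ)) * √b := by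
  have hνt : 0 < ν * t := mul_pos hν ht
  have ht1 : 0 < 1 + t := by linarith
  have hw : 0 < √(ν * t) * (1 + t) := by positivity
  rw [neg_div, Real.rpow_neg hνt.le, ← Real.sqrt_eq_rpow, Real.rpow_neg_one]
  have hmain : √(ν * t) * (1 + t) * (|k| * √a) ≤ C * √b := by
    calc √(ν * t) * (1 + t) * (|k| * √a) = √(ν * k ^ 2 * t * (1 + t) ^ 2 * a) := by
          rw [show ν * k ^ 2 * t * (1 + t) ^ 2 * a = (ν * t) * ((1 + t) ^ 2 * (k ^ 2 * a)) by ring,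
            Real.sqrt_mul hνt.le, Real.sqrt_mul (sq_nonneg _), Real.sqrt_mul (sq_nonneg _),
            Real.sqrt_sq ht1.le, Real.sqrt_sq_eq_abs]
          ring
      _ ≤ √(C ^ 2 * b) := Real.sqrt_le_sqrt h
      _ = C * √b := by rw [Real.sqrt_mul (sq_nonneg _), Real.sqrt_sq hC]
  calc |k| * √a = (√(ν * t) * (1 + t))⁻¹ * (√(ν * t) * (1 + t) * (|k| * √a)) := by
        rw [inv_mul_cancel_left₀ hw.ne']
    _ ≤ (√(ν * t) * (1 + t))⁻¹ * (C * √b) := by gcongr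
    _ = C * (√(ν * t))⁻¹ * (1 + t)⁻¹ * √b := by rw [mul_inv]; ring

/-- Enhanced dissipation for the drift–diffusion equation at `x`-frequency `k ≠ 0`:
`|k| ‖f(t)‖_{L²} ≤ C (νt)^{-1/2} (1+t)^{-1} ‖f(0)‖_{L²}`. -/
theorem enhanced_dissipation_kf :
    ∃ C > (0 : ℝ), ∀ (ν k : ℝ) (f ft fy fyy fty : ℝ → ℝ → ℂ),
      0 < ν → k ≠ 0 →
      ContinuousOn (fun p : ℝ × ℝ => f p.1 p.2) (Ici 0 ×ˢ Icc (-1) 1) →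
      ContinuousOn (fun p : ℝ × ℝ => ft p.1 p.2) (Ici 0 ×ˢ Icc (-1) 1) →
      ContinuousOn (fun p : ℝ × ℝ => fy p.1 p.2) (Ici 0 ×ˢ Icc (-1) 1) →
      ContinuousOn (fun p : ℝ × ℝ => fyy p.1 p.2) (Ici 0 ×ˢ Icc (-1) 1) →
      ContinuousOn (fun p : ℝ × ℝ => fty p.1 p.2) (Ici 0 ×ˢ Icc (-1) 1) →
      (∀ t ∈ Ici (0 : ℝ), ∀ y ∈ Icc (-1 : ℝ) 1,
        HasDerivAt (fun s => f s y) (ft t y) t) →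
      (∀ t ∈ Ici (0 : ℝ), ∀ y ∈ Icc (-1 : ℝ) 1,
        HasDerivAt (fun z => f t z) (fy t y) y) →
      (∀ t ∈ Ici (0 : ℝ), ∀ y ∈ Icc (-1 : ℝ) 1,
        HasDerivAt (fun z => fy t z) (fyy t y) y) →
      (∀ t ∈ Ici (0 : ℝ), ∀ y ∈ Icc (-1 : ℝ) 1,
        HasDerivAt (fun s => fy s y) (fty t y) t) →
      (∀ t ∈ Ici (0 : ℝ), ∀ y ∈ Ioo (-1 : ℝ) 1,
        ft t y = (ν : ℂ) * (fyy t y - (k : ℂ) ^ 2 * f t y)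
          - Complex.I * (k : ℂ) * (y : ℂ) * f t y) →
      (∀ t ∈ Ici (0 : ℝ), f t (-1) = 0 ∧ f t 1 = 0) →
      ∀ t : ℝ, 0 < t →
        |k| * L2norm (f t)
          ≤ C * (ν * t) ^ (-(1 : ℝ) / 2) * (1 + t) ^ (-(1 : ℝ)) * L2norm (f 0) := by
  refine ⟨28, by norm_num, ?_⟩
  intro ν k f ft fy fyy fty hν _ hf hft hfy hfyy hfty hdt hdy hdyy hdty heq hbc t ht
  have hle : (-1 : ℝ) ≤ 1 := by norm_num
  let e : ℝ → ℝ → ℝ := fun s y =>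
    energyDensity ν k s (f s y).re (f s y).im (fy s y).re (fy s y).im
  let et : ℝ → ℝ → ℝ := fun s y =>
    energyRate ν k s (f s y).re (f s y).im (ft s y).re (ft s y).im
      (fy s y).re (fy s y).im (fty s y).re (fty s y).im
  let d : ℝ → ℝ → ℝ := fun s y =>
    dissipation ν k s (f s y).re (f s y).im (fy s y).re (fy s y).im (fyy s y).re (fyy s y).im
  have he : ContinuousOn (fun p : ℝ × ℝ => e p.1 p.2) (Ici 0 ×ˢ Icc (-1) 1) := by
    simp only [e, energyDensity]
    fun_prop
  have het : ContinuousOn (fun p : ℝ × ℝ => et p.1 p.2) (Ici 0 ×ˢ Icc (-1) 1) := by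
    simp only [et, energyRate]
    fun_prop
  have hd : ContinuousOn (fun p : ℝ × ℝ => d p.1 p.2) (Ici 0 ×ˢ Icc (-1) 1) := by
    simp only [d, dissipation]
    fun_prop
  have hft_zero : ∀ s > 0, ∀ y ∈ Icc (-1 : ℝ) 1, (∀ r ∈ Ici (0 : ℝ), f r y = 0) →
      ft s y = 0 := by
    intro s hs y hy h0
    refine (hdt s hs.le y hy).unique ((hasDerivAt_const s (0 : ℂ)).congr_of_eventuallyEq ?_)
    filter_upwards [Ioi_mem_nhds hs] with r hr using h0 r (mem_Ici.2 (le_of_lt hr))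
  have hrate : ∀ s > 0, ∫ y in (-1 : ℝ)..1, et s y ≤ 0 := by
    intro s hs
    have hf' := continuousOn_slice hs.le hf
    have hft' := continuousOn_slice hs.le hft
    have hfy' := continuousOn_slice hs.le hfy
    have heti := (continuousOn_slice hs.le het).intervalIntegrable_of_Icc (μ := volume) hle
    have hdi := (continuousOn_slice hs.le hd).intervalIntegrable_of_Icc (μ := volume) hle
    have hflux := intervalIntegral.integral_eq_sub_of_hasDerivAt_of_le (f := fun y =>
        energyFlux ν k s y (f s y).re (f s y).im (ft s y).re (ft s y).im (fy s y).re (fy s y).im)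
      (f' := fun y => et s y + d s y) hle (by simp only [energyFlux]; fun_prop)
      (fun y hy => by
        have hy' := Ioo_subset_Icc_self hy
        have hmix := hasDerivAt_mixed_strip hs hy hfy hfty hdt hdy hdty
        refine hasDerivAt_energyFlux ν k s
          (hasDerivAt_re (hdy s hs.le y hy')) (hasDerivAt_im (hdy s hs.le y hy'))
          (hasDerivAt_re hmix) (hasDerivAt_im hmix)
          (hasDerivAt_re (hdyy s hs.le y hy')) (hasDerivAt_im (hdyy s hs.le y hy')) ?_ ?_
        · rw [heq s hs.le y hy]
          simp [pow_two]
        · rw [heq s hs.le y hy]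
          simp [pow_two])
      (heti.add hdi)
    have h₁ := hft_zero s hs 1 (by simp) fun r hr => (hbc r hr).2
    have h₂ := hft_zero s hs (-1) (by simp) fun r hr => (hbc r hr).1
    rw [intervalIntegral.integral_add heti hdi] at hflux
    simp only [(hbc s hs.le).1, (hbc s hs.le).2, h₁, h₂, energyFlux] at hflux
    have hd0 : 0 ≤ ∫ y in (-1 : ℝ)..1, d s y :=
      intervalIntegral.integral_nonneg hle fun y _ => dissipation_nonneg hν.le hs.le k _ _ _ _ _ _
    norm_num at hflux
    linarith
  have hanti : AntitoneOn (fun s => ∫ y in (-1 : ℝ)..1, e s y) (Ici 0) := by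
    refine antitoneOn_of_hasDerivWithinAt_nonpos (f' := fun s => ∫ y in (-1 : ℝ)..1, et s y)
      (convex_Ici 0) (continuousOn_integral_strip hle he) ?_ ?_
    · intro s hs
      rw [interior_Ici] at hs
      exact (hasDerivAt_integral_strip hle hs he het fun r hr y hy =>
        hasDerivAt_energyDensity ν k (hasDerivAt_re (hdt r hr y hy))
          (hasDerivAt_im (hdt r hr y hy)) (hasDerivAt_re (hdty r hr y hy))
          (hasDerivAt_im (hdty r hr y hy))).hasDerivWithinAt
    · intro s hs
      rw [interior_Ici] at hs
      exact hrate s hs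
  have hnorm : ∀ z : ℂ, ‖z‖ ^ 2 = z.re ^ 2 + z.im ^ 2 := fun z => by
    rw [Complex.sq_norm, Complex.normSq_apply]
    ring
  have hlower : ν * k ^ 2 * t * (1 + t) ^ 2 / 768 * ∫ y in (-1 : ℝ)..1, ‖f t y‖ ^ 2
      ≤ ∫ y in (-1 : ℝ)..1, e t y := by
    have hf' := continuousOn_slice ht.le hf
    rw [← intervalIntegral.integral_const_mul]
    refine intervalIntegral.integral_mono_on hle
      (ContinuousOn.intervalIntegrable_of_Icc hle (by fun_prop))
      ((continuousOn_slice ht.le he).intervalIntegrable_of_Icc hle) fun y _ => ?_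
    rw [hnorm]
    exact le_energyDensity hν.le ht.le k _ _ _ _
  have hinit : ∫ y in (-1 : ℝ)..1, e 0 y = ∫ y in (-1 : ℝ)..1, ‖f 0 y‖ ^ 2 := by
    simp [e, energyDensity, hnorm]
  have hdecay := hlower.trans ((hanti self_mem_Ici ht.le ht.le).trans_eq hinit)
  have hpos : 0 ≤ ∫ y in (-1 : ℝ)..1, ‖f 0 y‖ ^ 2 :=
    intervalIntegral.integral_nonneg hle fun y _ => by positivity
  exact mul_sqrt_le_of_mul_le hν ht (by norm_num) (by linarith)
end

section
/- There is a universal constant C > 0 with the following property. Let k, l ∈ ℝ \ {0} with k ≠ l, let t₀ < t₁ be real numbers, and let g : [t₀,t₁] × [−1,1] → ℂ be continuous, continuously differentiable in y, with g(t,−1) = g(t,1) = 0 for every t. Define f(t,y) = ∫_{t₀}^{t} e^{−i k y (t−τ)} g(τ,y) dτ (the solution of ∂_t f + i k y f = g with f(t₀,·) = 0). Suppose further that for each t, ψ(t,·) : [−1,1] → ℂ is twice continuously differentiable, ψ(t,−1) = ψ(t,1) = 0, and ∂²_y ψ(t,y) − k² ψ(t,y) = −f(t,y) for all y ∈ (−1,1),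 with ψ jointly continuous in (t,y) together with ∂_y ψ. Then sup_{t∈[t₀,t₁]} ‖f(t,·)‖²_{L²(−1,1)} + (|k| + |k|²) ∫_{t₀}^{t₁} (‖∂_y ψ(t,·)‖²_{L²} + k² ‖ψ(t,·)‖²_{L²}) dt ≤ C |k−l|^{−1} (1+|k−l|²)^{−1/2} ∫_{t₀}^{t₁} ( ‖∂_y( y ↦ e^{i l y t} g(t,y) )‖²_{L²} + (1+|k−l|²) ‖g(t,·)‖²_{L²} ) dt. -/
open Set

/-- The squared `L²` norm of a function on the interval `(-1, 1)`. -/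
noncomputable def L2sq (h : ℝ → ℂ) : ℝ :=
  ∫ y in (-1 : ℝ)..1, ‖h y‖ ^ 2

open MeasureTheory Real

/-- The Fourier transform of a function on `(-1, 1)` extended by zero. -/
noncomputable def fourierOn (h : ℝ → ℂ) (ξ : ℝ) : ℂ :=
  ∫ y in (-1 : ℝ)..1, Complex.exp (-Complex.I * ξ * y) * h y

lemma L2sq_nonneg (h : ℝ → ℂ) : 0 ≤ L2sq h :=
  intervalIntegral.integral_nonneg (by norm_num) fun _ _ => by positivity

lemma L2sq_congr {h₁ h₂ : ℝ → ℂ} (h : ∀ y ∈ Icc (-1 : ℝ) 1, ‖h₁ y‖ = ‖h₂ y‖) :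
    L2sq h₁ = L2sq h₂ := by
  refine intervalIntegral.integral_congr fun y hy => ?_
  rw [uIcc_of_le (by norm_num)] at hy
  simp only [h y hy]

/-- Parseval's identity on `(-1, 1)` for the frequencies `πn + θ`. -/
lemma hasSum_sq_fourierOn {h : ℝ → ℂ} (hh : Continuous h) (θ : ℝ) :
    HasSum (fun n : ℤ => ‖fourierOn h (π * n + θ)‖ ^ 2) (2 * L2sq h) := by
  set u : ℝ → ℂ := fun y => Complex.exp (-Complex.I * θ * y) * h y with hu
  have hc : Continuous u := by fun_prop
  have hL : MemLp u 2 (volume.restrict (Ioc (-1 : ℝ) 1)) := by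
    obtain ⟨C, hC⟩ := isCompact_Icc.exists_bound_of_continuousOn (hc.continuousOn (s := Icc (-1) 1))
    exact MemLp.of_bound hc.aestronglyMeasurable C
      ((ae_restrict_iff' measurableSet_Ioc).mpr
        (.of_forall fun y hy => hC y (Ioc_subset_Icc_self hy)))
  have H := (hasSum_sq_fourierCoeffOn (by norm_num : (-1 : ℝ) < 1) hL).mul_left 4
  have e1 : (4 : ℝ) * (((1 : ℝ) - (-1))⁻¹ • ∫ x in (-1 : ℝ)..1, ‖u x‖ ^ 2) = 2 * L2sq h := by
    have : ∀ x, ‖u x‖ = ‖h x‖ := fun x => by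
      simp [hu, Complex.norm_exp]
    simp only [this, L2sq, smul_eq_mul]
    ring
  rw [e1] at H
  refine (congrArg (fun u => HasSum u _) (funext fun n => ?_)).mpr H
  have e2 : fourierOn h (π * n + θ) = 2 * fourierCoeffOn (by norm_num : (-1 : ℝ) < 1) u n := by
    rw [fourierCoeffOn_eq_integral, fourierOn]
    have : ∀ y : ℝ, fourier (-n) (y : AddCircle ((1 : ℝ) - (-1))) • u y
        = Complex.exp (-Complex.I * (π * n + θ : ℝ) * y) * h y := fun y => by
      rw [fourier_coe_apply, hu, smul_eq_mul, ← mul_assoc, ← Complex.exp_add]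
      congr 2
      push_cast
      ring
    simp only [this]
    rw [Complex.real_smul]
    push_cast
    ring
  rw [e2, norm_mul]
  norm_num
  ring

lemma fourierOn_deriv {h h' : ℝ → ℂ} (hh : Continuous h) (hh' : Continuous h')
    (hd : ∀ y ∈ Ioo (-1 : ℝ) 1, HasDerivAt h (h' y) y) (h₀ : h (-1) = 0) (h₁ : h 1 = 0) (ξ : ℝ) :
    fourierOn h' ξ = Complex.I * ξ * fourierOn h ξ := by
  have he : ∀ y : ℝ, HasDerivAt (fun y : ℝ => Complex.exp (-Complex.I * ξ * y))
      (Complex.exp (-Complex.I * ξ * y) * (-Complex.I * ξ)) y := fun y => by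
    have := ((Complex.ofRealCLM.hasDerivAt (x := y)).const_mul (-Complex.I * ξ)).cexp
    simpa using this
  have H := intervalIntegral.integral_mul_deriv_eq_deriv_mul_of_hasDerivAt (a := -1) (b := 1)
    (u := fun y : ℝ => Complex.exp (-Complex.I * ξ * y)) (v := h)
    (by fun_prop) hh.continuousOn (fun y _ => he y)
    (fun y hy => hd y (by simpa using hy))
    (Continuous.intervalIntegrable (by fun_prop) _ _) (hh'.intervalIntegrable _ _)
  rw [fourierOn, H, h₀, h₁, fourierOn, ← intervalIntegral.integral_const_mul]
  simp only [mul_zero, sub_self, zero_sub, ← intervalIntegral.integral_neg]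
  congr 1
  ext y
  ring

lemma fourierOn_add {h₁ h₂ : ℝ → ℂ} (hh₁ : Continuous h₁) (hh₂ : Continuous h₂) (c : ℂ) (ξ : ℝ) :
    fourierOn (fun y => h₁ y + c * h₂ y) ξ = fourierOn h₁ ξ + c * fourierOn h₂ ξ := by
  rw [fourierOn, fourierOn, fourierOn, ← intervalIntegral.integral_const_mul,
    ← intervalIntegral.integral_add (Continuous.intervalIntegrable (by fun_prop) _ _)
      (Continuous.intervalIntegrable (by fun_prop) _ _)]
  congr 1
  ext y
  ring

/-- Parseval's identity for the twisted derivative `∂_y + is`, with a zeroth order term. -/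
lemma hasSum_weight_mul_sq_fourierOn {h h' : ℝ → ℂ} (hh : Continuous h) (hh' : Continuous h')
    (hd : ∀ y ∈ Ioo (-1 : ℝ) 1, HasDerivAt h (h' y) y) (h₀ : h (-1) = 0) (h₁ : h 1 = 0)
    (θ s c : ℝ) :
    HasSum (fun n : ℤ => (c + (π * n + θ + s) ^ 2) * ‖fourierOn h (π * n + θ)‖ ^ 2)
      (2 * (L2sq (fun y => h' y + Complex.I * s * h y) + c * L2sq h)) := by
  have H := (hasSum_sq_fourierOn (h := fun y => h' y + Complex.I * s * h y) (by fun_prop) θ).add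
    ((hasSum_sq_fourierOn hh θ).mul_left c)
  rw [show 2 * (L2sq (fun y => h' y + Complex.I * s * h y) + c * L2sq h)
    = 2 * L2sq (fun y => h' y + Complex.I * s * h y) + c * (2 * L2sq h) by ring]
  refine (congrArg (fun u => HasSum u _) (funext fun n => ?_)).mpr H
  · rw [fourierOn_add hh' hh, fourierOn_deriv hh hh' hd h₀ h₁]
    have : Complex.I * ((π * n + θ : ℝ) : ℂ) * fourierOn h (π * n + θ)
        + Complex.I * s * fourierOn h (π * n + θ)
        = Complex.I * ((π * n + θ + s : ℝ) : ℂ) * fourierOn h (π * n + θ) := by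
      push_cast
      ring
    rw [this, norm_mul, norm_mul, Complex.norm_I, Complex.norm_real, mul_pow, one_mul,
      Real.norm_eq_abs, sq_abs]
    ring

lemma intervalIntegral_inv_add_sq_le {A m : ℝ} (hA : 0 < A) (hm : m ≠ 0) (η a b : ℝ) :
    ∫ τ in a..b, (A ^ 2 + (η - m * τ) ^ 2)⁻¹ ≤ π / (|m| * A) := by
  have hpos : ∀ τ, 0 < A ^ 2 + (η - m * τ) ^ 2 := fun τ => by positivity
  have hd : ∀ τ, HasDerivAt (fun τ => -(m * A)⁻¹ * arctan ((η - m * τ) / A))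
      ((A ^ 2 + (η - m * τ) ^ 2)⁻¹) τ := fun τ => by
    have h1 : HasDerivAt (fun τ => (η - m * τ) / A) (-m / A) τ := by
      have := (((hasDerivAt_id τ).const_mul m).const_sub η).div_const A
      simpa using this
    have := h1.arctan.const_mul (-(m * A)⁻¹)
    refine this.congr_deriv ?_
    have := (hpos τ).ne'
    have h2 : 1 + ((η - m * τ) / A) ^ 2 = (A ^ 2 + (η - m * τ) ^ 2) / A ^ 2 := by
      field_simp
    rw [h2]
    field_simp
  rw [intervalIntegral.integral_eq_sub_of_hasDerivAt (fun τ _ => hd τ)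
    (Continuous.intervalIntegrable (by
      refine Continuous.inv₀ (by fun_prop) fun τ => (hpos τ).ne') _ _)]
  set x := arctan ((η - m * a) / A)
  set z := arctan ((η - m * b) / A)
  have hx1 : x < π / 2 := arctan_lt_pi_div_two _
  have hx2 : -(π / 2) < x := neg_pi_div_two_lt_arctan _
  have hz1 : z < π / 2 := arctan_lt_pi_div_two _
  have hz2 : -(π / 2) < z := neg_pi_div_two_lt_arctan _
  have : -(m * A)⁻¹ * z - -(m * A)⁻¹ * x = (m * A)⁻¹ * (x - z) := by ring
  rw [this]
  refine (le_abs_self _).trans ?_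
  rw [abs_mul, abs_inv, abs_mul, abs_of_pos hA, div_eq_inv_mul]
  refine mul_le_mul_of_nonneg_left ?_ (by positivity)
  rw [abs_le]
  constructor <;> linarith

/-- Weighted Cauchy–Schwarz inequality for an interval integral. -/
lemma sq_norm_intervalIntegral_le {a b B : ℝ} (hab : a ≤ b) {h : ℝ → ℂ} {w : ℝ → ℝ}
    (hh : Continuous h) (hw : Continuous w) (hpos : ∀ τ, 0 < w τ) (hB : 0 < B)
    (hI : ∫ τ in a..b, (w τ)⁻¹ ≤ B) :
    ‖∫ τ in a..b, h τ‖ ^ 2 ≤ B * ∫ τ in a..b, w τ * ‖h τ‖ ^ 2 := by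
  set N := ‖∫ τ in a..b, h τ‖ with hN
  set J := ∫ τ in a..b, w τ * ‖h τ‖ ^ 2 with hJ
  have hJ0 : 0 ≤ J := intervalIntegral.integral_nonneg hab fun τ _ => by
    have := hpos τ
    positivity
  rcases (norm_nonneg (∫ τ in a..b, h τ)).eq_or_lt with h0 | h0
  · rw [← hN] at h0
    rw [← h0, zero_pow two_ne_zero]
    exact mul_nonneg hB.le hJ0
  rw [← hN] at h0
  have hwi : Continuous fun τ => (w τ)⁻¹ := hw.inv₀ fun τ => (hpos τ).ne'
  have key : ∀ c : ℝ, 2 * c * N ≤ c ^ 2 * B + J := fun c => by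
    rcases le_or_gt c 0 with hc | hc
    · nlinarith [sq_nonneg c]
    have h1 : N ≤ ∫ τ in a..b, ‖h τ‖ := intervalIntegral.norm_integral_le_integral_norm hab
    have h2 : ∫ τ in a..b, 2 * c * ‖h τ‖ ≤ ∫ τ in a..b, (c ^ 2 * (w τ)⁻¹ + w τ * ‖h τ‖ ^ 2) := by
      refine intervalIntegral.integral_mono_on hab
        (Continuous.intervalIntegrable (by fun_prop) _ _)
        (Continuous.intervalIntegrable (by fun_prop) _ _) fun τ _ => ?_
      have hp := hpos τ
      have : c ^ 2 * (w τ)⁻¹ + w τ * ‖h τ‖ ^ 2 - 2 * c * ‖h τ‖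
          = (w τ)⁻¹ * (c - w τ * ‖h τ‖) ^ 2 := by
        field_simp
        ring
      have : 0 ≤ (w τ)⁻¹ * (c - w τ * ‖h τ‖) ^ 2 := by positivity
      linarith
    rw [intervalIntegral.integral_const_mul, intervalIntegral.integral_add
      (Continuous.intervalIntegrable (by fun_prop) _ _)
      (Continuous.intervalIntegrable (by fun_prop) _ _), intervalIntegral.integral_const_mul] at h2
    have h3 := mul_le_mul_of_nonneg_left h1 (by positivity : 0 ≤ 2 * c)
    have h4 := mul_le_mul_of_nonneg_left hI (by positivity : 0 ≤ c ^ 2)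
    linarith
  have := key (N / B)
  field_simp at this
  nlinarith

/-- Weighted Poincaré inequality on `(-1, 1)`. -/
lemma L2sq_le_four_mul_L2sq_deriv {p p' : ℝ → ℂ} (hp : Continuous p) (hp' : Continuous p')
    (hd : ∀ y ∈ Ioo (-1 : ℝ) 1, HasDerivAt p (p' y) y) (h₀ : p (-1) = 0) (h₁ : p 1 = 0) :
    L2sq p ≤ 4 * L2sq p' := by
  have H := intervalIntegral.integral_eq_sub_of_hasDerivAt_of_le (a := -1) (b := 1)
    (f := fun y => y * ‖p y‖ ^ 2) (f' := fun y => 1 * ‖p y‖ ^ 2 + y * (2 * inner ℝ (p y) (p' y)))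
    (by norm_num) (by fun_prop) (fun y hy => (hasDerivAt_id y).mul (hd y hy).norm_sq)
    (Continuous.intervalIntegrable (by fun_prop) _ _)
  have H2 : ∫ y in (-1 : ℝ)..1, ((1 / 2) * ‖p y‖ ^ 2 - 2 * ‖p' y‖ ^ 2)
      ≤ ∫ y in (-1 : ℝ)..1, (1 * ‖p y‖ ^ 2 + y * (2 * inner ℝ (p y) (p' y))) := by
    refine intervalIntegral.integral_mono_on (by norm_num)
      (Continuous.intervalIntegrable (by fun_prop) _ _)
      (Continuous.intervalIntegrable (by fun_prop) _ _) fun y hy => ?_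
    have h1 : |y * inner ℝ (p y) (p' y)| ≤ 1 * (‖p y‖ * ‖p' y‖) := by
      rw [abs_mul]
      exact mul_le_mul (abs_le.mpr hy) (abs_real_inner_le_norm _ _) (abs_nonneg _) zero_le_one
    have := (abs_le.mp h1).1
    nlinarith [sq_nonneg (‖p y‖ - 2 * ‖p' y‖)]
  rw [H, intervalIntegral.integral_sub (Continuous.intervalIntegrable (by fun_prop) _ _)
    (Continuous.intervalIntegrable (by fun_prop) _ _), intervalIntegral.integral_const_mul,
    intervalIntegral.integral_const_mul, h₀, h₁] at H2
  simp only [L2sq]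
  norm_num at H2
  linarith

/-- Elliptic estimate `‖p‖_{H¹_k} ≲ ‖F‖_{H⁻¹_k}`, with the right-hand side expressed through
Fourier coefficients at the frequencies `πn + θ`. -/
lemma elliptic_energy_le {F p p' : ℝ → ℂ} {k θ S : ℝ} {a : ℤ → ℝ} (hF : Continuous F)
    (hp : Continuous p) (hp' : Continuous p')
    (hd : ∀ y ∈ Ioo (-1 : ℝ) 1, HasDerivAt p (p' y) y)
    (hd' : ∀ y ∈ Ioo (-1 : ℝ) 1, HasDerivAt p' ((k : ℂ) ^ 2 * p y - F y) y)
    (h₀ : p (-1) = 0) (h₁ : p 1 = 0)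
    (ha : ∀ n : ℤ, ‖fourierOn F (π * n + θ)‖ ^ 2 ≤ a n)
    (hS : HasSum (fun n : ℤ => a n * (1 + k ^ 2 + (π * n + θ) ^ 2)⁻¹) S) :
    L2sq p' + k ^ 2 * L2sq p ≤ 5 / 2 * S := by
  have hpoin := L2sq_le_four_mul_L2sq_deriv hp hp' hd h₀ h₁
  have henergy : ∫ y in (-1 : ℝ)..1, inner ℝ (p y) (F y) = L2sq p' + k ^ 2 * L2sq p := by
    have H := intervalIntegral.integral_eq_sub_of_hasDerivAt_of_le (a := -1) (b := 1)
      (f := fun y => inner ℝ (p y) (p' y))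
      (f' := fun y => inner ℝ (p y) ((k : ℂ) ^ 2 * p y - F y) + inner ℝ (p' y) (p' y))
      (by norm_num) (by fun_prop) (fun y hy => (hd y hy).inner ℝ (hd' y hy))
      (Continuous.intervalIntegrable (by fun_prop) _ _)
    have e : ∀ y, inner ℝ (p y) ((k : ℂ) ^ 2 * p y - F y) + inner ℝ (p' y) (p' y)
        = k ^ 2 * ‖p y‖ ^ 2 + ‖p' y‖ ^ 2 - inner ℝ (p y) (F y) := fun y => by
      have : (k : ℂ) ^ 2 * p y = (k ^ 2) • p y := by
        rw [Complex.real_smul]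
        push_cast
        rfl
      rw [this, inner_sub_right, real_inner_smul_right, real_inner_self_eq_norm_sq,
        real_inner_self_eq_norm_sq]
      ring
    simp only [e, h₀, h₁, inner_zero_left, sub_zero] at H
    rw [intervalIntegral.integral_sub (Continuous.intervalIntegrable (by fun_prop) _ _)
      (Continuous.intervalIntegrable (by fun_prop) _ _),
      intervalIntegral.integral_add (Continuous.intervalIntegrable (by fun_prop) _ _)
      (Continuous.intervalIntegrable (by fun_prop) _ _), intervalIntegral.integral_const_mul] at H
    simp only [L2sq]
    linarith
  have hpol : 2 * L2sq (fun y => F y + 1 * p y) - 2 * L2sq (fun y => F y + (-1) * p y)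
      = 8 * (L2sq p' + k ^ 2 * L2sq p) := by
    rw [← henergy, L2sq, L2sq, ← mul_sub, ← intervalIntegral.integral_sub
      (Continuous.intervalIntegrable (by fun_prop) _ _)
      (Continuous.intervalIntegrable (by fun_prop) _ _), ← intervalIntegral.integral_const_mul,
      ← intervalIntegral.integral_const_mul]
    congr 1
    ext y
    rw [one_mul, neg_one_mul, ← sub_eq_add_neg, norm_add_sq_real, norm_sub_sq_real,
      real_inner_comm]
    ring
  have hsum := (hasSum_sq_fourierOn (h := fun y => F y + 1 * p y) (by fun_prop) θ).sub
    (hasSum_sq_fourierOn (h := fun y => F y + (-1) * p y) (by fun_prop) θ)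
  rw [hpol] at hsum
  have hw := hasSum_weight_mul_sq_fourierOn hp hp' hd h₀ h₁ θ 0 (1 + k ^ 2)
  have hle := hasSum_le (fun n => ?_) hsum ((hS.mul_left 10).add (hw.mul_left (2 / 5)))
  · have e : (fun y => p' y + Complex.I * (0 : ℝ) * p y) = p' := by
      ext y
      simp
    rw [e] at hle
    have := mul_nonneg (sq_nonneg k) (L2sq_nonneg p)
    linarith
  · rw [fourierOn_add hF hp, fourierOn_add hF hp, one_mul, neg_one_mul, ← sub_eq_add_neg,
      norm_add_sq_real, norm_sub_sq_real, add_zero]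
    set x := fourierOn F (π * n + θ)
    set z := fourierOn p (π * n + θ)
    set w := 1 + k ^ 2 + (π * n + θ) ^ 2 with hwdef
    have hwpos : 0 < w := by positivity
    have h1 : inner ℝ x z ≤ ‖x‖ * ‖z‖ := real_inner_le_norm _ _
    have h2 : ‖x‖ ^ 2 * w⁻¹ ≤ a n * w⁻¹ := mul_le_mul_of_nonneg_right (ha n) (by positivity)
    have h3 : 10 * (‖x‖ ^ 2 * w⁻¹) + 2 / 5 * (w * ‖z‖ ^ 2) - 4 * (‖x‖ * ‖z‖)
        = 2 / 5 * w⁻¹ * (5 * ‖x‖ - w * ‖z‖) ^ 2 := by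
      field_simp
      ring
    have h4 : 0 ≤ 2 / 5 * w⁻¹ * (5 * ‖x‖ - w * ‖z‖) ^ 2 := by positivity
    linarith

lemma fourierOn_duhamel {g : ℝ → ℝ → ℂ} (hg : Continuous (Function.uncurry g)) (k t₀ t η : ℝ) :
    fourierOn (fun y => ∫ τ in t₀..t,
        Complex.exp (-Complex.I * (k : ℂ) * (y : ℂ) * ((t : ℂ) - (τ : ℂ))) * g τ y) (η - k * t)
      = ∫ τ in t₀..t, fourierOn (g τ) (η - k * τ) := by
  have hg' : Continuous fun q : ℝ × ℝ => g q.2 q.1 := hg.comp continuous_swap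
  have e : ∀ y : ℝ, Complex.exp (-Complex.I * (η - k * t : ℝ) * y) * (∫ τ in t₀..t,
      Complex.exp (-Complex.I * (k : ℂ) * (y : ℂ) * ((t : ℂ) - (τ : ℂ))) * g τ y)
      = ∫ τ in t₀..t, Complex.exp (-Complex.I * (η - k * τ : ℝ) * y) * g τ y := fun y => by
    rw [← intervalIntegral.integral_const_mul]
    congr 1
    ext τ
    rw [← mul_assoc, ← Complex.exp_add]
    congr 2
    push_cast
    ring
  simp only [fourierOn, e]
  refine intervalIntegral_intervalIntegral_swap ?_
  have hc : Continuous (Function.uncurry fun y τ : ℝ =>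
      Complex.exp (-Complex.I * (η - k * τ : ℝ) * y) * g τ y) := by
    simp only [Function.uncurry_def]
    fun_prop
  exact (hc.continuousOn.integrableOn_compact (isCompact_uIcc.prod isCompact_uIcc)).mono_set
    (prod_mono uIoc_subset_uIcc uIoc_subset_uIcc)

lemma continuous_fourierOn {g : ℝ → ℝ → ℂ} (hg : Continuous (Function.uncurry g)) {ξ : ℝ → ℝ}
    (hξ : Continuous ξ) : Continuous fun τ => fourierOn (g τ) (ξ τ) := by
  refine intervalIntegral.continuous_parametric_intervalIntegral_of_continuous' ?_ _ _
  simp only [Function.uncurry_def] at hg ⊢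
  fun_prop

lemma continuous_L2sq {g : ℝ → ℝ → ℂ} (hg : Continuous (Function.uncurry g)) :
    Continuous fun τ => L2sq (g τ) := by
  refine intervalIntegral.continuous_parametric_intervalIntegral_of_continuous' ?_ _ _
  simp only [Function.uncurry_def] at hg ⊢
  fun_prop

lemma exists_continuous_extension {E : Type*} [TopologicalSpace E] {a b c d : ℝ} (hab : a ≤ b)
    (hcd : c ≤ d) {u : ℝ → ℝ → E}
    (hu : ContinuousOn (fun p : ℝ × ℝ => u p.1 p.2) (Icc a b ×ˢ Icc c d)) :
    ∃ v : ℝ → ℝ → E, Continuous (Function.uncurry v) ∧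
      ∀ t ∈ Icc a b, ∀ y ∈ Icc c d, v t y = u t y := by
  refine ⟨fun t y => u (projIcc a b hab t) (projIcc c d hcd y), ?_, fun t ht y hy => ?_⟩
  · refine hu.comp_continuous
      (f := fun q : ℝ × ℝ => ((projIcc a b hab q.1 : ℝ), (projIcc c d hcd q.2 : ℝ))) ?_
      fun q => ⟨(projIcc a b hab q.1).2, (projIcc c d hcd q.2).2⟩
    have := continuous_projIcc (h := hab)
    have := continuous_projIcc (h := hcd)
    fun_prop
  · simp only [projIcc_of_mem _ ht, projIcc_of_mem _ hy]

/-- Weighted `L²_t` norm of the Fourier transform of `g` along the characteristic `η - kτ`. -/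
noncomputable def characteristicEnergy (g : ℝ → ℝ → ℂ) (k m t₀ t₁ η : ℝ) : ℝ :=
  ∫ τ in t₀..t₁, (1 + m ^ 2 + (η - m * τ) ^ 2) * ‖fourierOn (g τ) (η - k * τ)‖ ^ 2

lemma characteristicEnergy_nonneg (g : ℝ → ℝ → ℂ) (k m η : ℝ) {t₀ t₁ : ℝ} (ht : t₀ ≤ t₁) :
    0 ≤ characteristicEnergy g k m t₀ t₁ η :=
  intervalIntegral.integral_nonneg ht fun _ _ => by positivity

/-- The source norm `∫ ‖∂_y(e^{ilyt} g)‖² + (1 + |k-l|²) ‖g‖² dt`. -/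
noncomputable def sourceEnergy (g gy : ℝ → ℝ → ℂ) (k l t₀ t₁ : ℝ) : ℝ :=
  ∫ t in t₀..t₁, (L2sq (fun y => Complex.exp (Complex.I * (l : ℂ) * (y : ℂ) * (t : ℂ))
    * (gy t y + Complex.I * (l : ℂ) * (t : ℂ) * g t y)) + (1 + |k - l| ^ 2) * L2sq (g t))

lemma sum_characteristicEnergy_le {k l t₀ t₁ : ℝ} {g gy : ℝ → ℝ → ℂ} (ht : t₀ ≤ t₁)
    (hg : Continuous (Function.uncurry g))
    (hgy : Continuous (Function.uncurry gy))
    (hd : ∀ t ∈ Icc t₀ t₁, ∀ y ∈ Ioo (-1 : ℝ) 1, HasDerivAt (g t) (gy t y) y)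
    (hbd : ∀ t ∈ Icc t₀ t₁, g t (-1) = 0 ∧ g t 1 = 0) (s : Finset ℤ) :
    ∑ n ∈ s, characteristicEnergy g k (k - l) t₀ t₁ (π * n) ≤ 2 * sourceEnergy g gy k l t₀ t₁ := by
  have hcF : ∀ η : ℝ, Continuous fun τ => fourierOn (g τ) (η - k * τ) := fun η =>
    continuous_fourierOn hg (by fun_prop)
  have hcg := continuous_L2sq hg
  have hc : Continuous fun t : ℝ => L2sq (fun y : ℝ =>
      Complex.exp (Complex.I * (l : ℂ) * (y : ℂ) * (t : ℂ))
        * (gy t y + Complex.I * (l : ℂ) * (t : ℂ) * g t y)) := by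
    refine continuous_L2sq ?_
    simp only [Function.uncurry_def] at hg hgy ⊢
    fun_prop
  have hcJ : ∀ η : ℝ, Continuous fun τ => (1 + (k - l) ^ 2 + (η - (k - l) * τ) ^ 2)
      * ‖fourierOn (g τ) (η - k * τ)‖ ^ 2 := fun η => by
    have := hcF η
    fun_prop
  simp only [characteristicEnergy]
  rw [← intervalIntegral.integral_finsetSum fun n _ => (hcJ _).intervalIntegrable _ _,
    sourceEnergy, ← intervalIntegral.integral_const_mul]
  refine intervalIntegral.integral_mono_on ht
    ((continuous_finsetSum _ fun n _ => hcJ _).intervalIntegrable _ _)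
    (Continuous.intervalIntegrable (by fun_prop) _ _) fun t htt => ?_
  have hgt : Continuous (g t) := hg.uncurry_left t
  have hgyt : Continuous (gy t) := hgy.uncurry_left t
  have H := hasSum_weight_mul_sq_fourierOn hgt hgyt (hd t htt) (hbd t htt).1
    (hbd t htt).2 (-(k * t)) (l * t) (1 + (k - l) ^ 2)
  have H2 := sum_le_hasSum s (fun n _ => by positivity) H
  have e1 : L2sq (fun y => Complex.exp (Complex.I * (l : ℂ) * (y : ℂ) * (t : ℂ))
      * (gy t y + Complex.I * (l : ℂ) * (t : ℂ) * g t y))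
      = L2sq (fun y => gy t y + Complex.I * (l * t : ℝ) * g t y) := by
    refine L2sq_congr fun y _ => ?_
    rw [norm_mul, Complex.norm_exp]
    simp [mul_assoc]
  rw [e1, sq_abs]
  refine le_trans (le_of_eq (Finset.sum_congr rfl fun n _ => ?_)) H2
  rw [← sub_eq_add_neg]
  ring

/-- The solution of `∂_t f + iky f = g` with zero data at time `t₀`. -/
noncomputable def duhamel (g : ℝ → ℝ → ℂ) (k t₀ t y : ℝ) : ℂ :=
  ∫ τ in t₀..t, Complex.exp (-Complex.I * (k : ℂ) * (y : ℂ) * ((t : ℂ) - (τ : ℂ))) * g τ y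

lemma continuous_duhamel {g : ℝ → ℝ → ℂ} (hg : Continuous (Function.uncurry g)) (k t₀ t : ℝ) :
    Continuous (duhamel g k t₀ t) := by
  refine intervalIntegral.continuous_parametric_intervalIntegral_of_continuous' ?_ _ _
  have hg' : Continuous fun q : ℝ × ℝ => g q.2 q.1 := hg.comp continuous_swap
  simp only [Function.uncurry_def]
  fun_prop

lemma sq_norm_fourierOn_duhamel_le {g : ℝ → ℝ → ℂ} (hg : Continuous (Function.uncurry g))
    {m t₀ t₁ t : ℝ} (hm : m ≠ 0) (ht : t ∈ Icc t₀ t₁) (k η : ℝ) :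
    ‖fourierOn (duhamel g k t₀ t) (η - k * t)‖ ^ 2
      ≤ π / (|m| * √(1 + m ^ 2)) * characteristicEnergy g k m t₀ t₁ η := by
  have hA : 0 < √(1 + m ^ 2) := by positivity
  have hcF : Continuous fun τ => fourierOn (g τ) (η - k * τ) :=
    continuous_fourierOn hg (by fun_prop)
  have hI := intervalIntegral_inv_add_sq_le hA hm η t₀ t
  rw [Real.sq_sqrt (by positivity)] at hI
  have H := sq_norm_intervalIntegral_le (w := fun τ => 1 + m ^ 2 + (η - m * τ) ^ 2) ht.1 hcF
    (by fun_prop) (fun τ => by positivity) (by positivity) hI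
  have e : fourierOn (duhamel g k t₀ t) (η - k * t) = ∫ τ in t₀..t, fourierOn (g τ) (η - k * τ) :=
    fourierOn_duhamel hg k t₀ t η
  rw [e]
  refine H.trans (mul_le_mul_of_nonneg_left ?_ (by positivity))
  refine intervalIntegral.integral_mono_interval le_rfl ht.1 ht.2
    (.of_forall fun τ => by positivity) (Continuous.intervalIntegrable (by fun_prop) _ _)

lemma two_mul_L2sq_duhamel_le {g : ℝ → ℝ → ℂ} (hg : Continuous (Function.uncurry g))
    {m t₀ t₁ t J : ℝ} (hm : m ≠ 0) (ht : t ∈ Icc t₀ t₁) {k : ℝ}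
    (hJ : HasSum (fun n : ℤ => characteristicEnergy g k m t₀ t₁ (π * n)) J) :
    2 * L2sq (duhamel g k t₀ t) ≤ π / (|m| * √(1 + m ^ 2)) * J :=
  hasSum_le (fun n : ℤ => sq_norm_fourierOn_duhamel_le hg hm ht k (π * n))
    (hasSum_sq_fourierOn (continuous_duhamel hg k t₀ t) (-(k * t))) (hJ.mul_left _)

lemma integral_stream_energy_le {g p p' : ℝ → ℝ → ℂ} (hg : Continuous (Function.uncurry g))
    {k m t₀ t₁ J : ℝ} (hk : k ≠ 0) (hm : m ≠ 0) (ht : t₀ ≤ t₁)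
    (hJ : HasSum (fun n : ℤ => characteristicEnergy g k m t₀ t₁ (π * n)) J)
    (hp : Continuous (Function.uncurry p)) (hp' : Continuous (Function.uncurry p'))
    (hd : ∀ t ∈ Icc t₀ t₁, ∀ y ∈ Ioo (-1 : ℝ) 1, HasDerivAt (p t) (p' t y) y)
    (hd' : ∀ t ∈ Icc t₀ t₁, ∀ y ∈ Ioo (-1 : ℝ) 1,
      HasDerivAt (p' t) ((k : ℂ) ^ 2 * p t y - duhamel g k t₀ t y) y)
    (hbd : ∀ t ∈ Icc t₀ t₁, p t (-1) = 0 ∧ p t 1 = 0) :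
    ∫ t in t₀..t₁, (L2sq (p' t) + k ^ 2 * L2sq (p t))
      ≤ 5 / 2 * (π / (|m| * √(1 + m ^ 2)) * J * (π / (|k| * √(1 + k ^ 2)))) := by
  set B := π / (|m| * √(1 + m ^ 2)) with hB
  have hB0 : 0 < B := by positivity
  set a : ℤ → ℝ := fun n => B * characteristicEnergy g k m t₀ t₁ (π * n) with ha
  have ha0 : ∀ n, 0 ≤ a n := fun n => mul_nonneg hB0.le (characteristicEnergy_nonneg g k m _ ht)
  have haJ : HasSum a (B * J) := hJ.mul_left B
  set F : ℤ → ℝ → ℝ := fun n t => a n * (1 + k ^ 2 + (π * n - k * t) ^ 2)⁻¹ with hF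
  have hFc : ∀ n, Continuous (F n) := fun n =>
    continuous_const.mul (Continuous.inv₀ (by fun_prop) fun t => by positivity)
  have hFle : ∀ n t, ‖F n t‖ ≤ a n := fun n t => by
    have hnn : 0 ≤ F n t := mul_nonneg (ha0 n) (by positivity)
    rw [Real.norm_of_nonneg hnn]
    refine mul_le_of_le_one_right (ha0 n) (inv_le_one_of_one_le₀ ?_)
    nlinarith [sq_nonneg k, sq_nonneg (π * n - k * t)]
  have hFs : ∀ t, HasSum (fun n => F n t) (∑' n, F n t) := fun t =>
    (Summable.of_norm_bounded haJ.summable fun n => hFle n t).hasSum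
  have hFi : HasSum (fun n => ∫ t in t₀..t₁, F n t) (∫ t in t₀..t₁, ∑' n, F n t) :=
    intervalIntegral.hasSum_integral_of_dominated_convergence (fun n _ => a n)
      (fun n => (hFc n).aestronglyMeasurable) (fun n => .of_forall fun t _ => hFle n t)
      (.of_forall fun t _ => haJ.summable) (continuous_const.intervalIntegrable _ _)
      (.of_forall fun t _ => hFs t)
  have hint : ∀ n, ∫ t in t₀..t₁, F n t ≤ a n * (π / (|k| * √(1 + k ^ 2))) := fun n => by
    have hI := intervalIntegral_inv_add_sq_le (A := √(1 + k ^ 2)) (by positivity) hk (π * n) t₀ t₁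
    rw [Real.sq_sqrt (by positivity)] at hI
    rw [hF, intervalIntegral.integral_const_mul]
    exact mul_le_mul_of_nonneg_left hI (ha0 n)
  have hpc := continuous_L2sq hp
  have hpc' := continuous_L2sq hp'
  have hmono : ∫ t in t₀..t₁, (L2sq (p' t) + k ^ 2 * L2sq (p t))
      ≤ ∫ t in t₀..t₁, 5 / 2 * ∑' n, F n t := by
    refine intervalIntegral.integral_mono_on ht (Continuous.intervalIntegrable (by fun_prop) _ _)
      ((continuous_const.mul (continuous_tsum hFc haJ.summable hFle)).intervalIntegrable _ _)
      fun t htt => ?_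
    exact elliptic_energy_le (θ := -(k * t)) (a := a) (continuous_duhamel hg k t₀ t)
      (hp.uncurry_left t) (hp'.uncurry_left t) (hd t htt) (hd' t htt) (hbd t htt).1 (hbd t htt).2
      (fun n => sq_norm_fourierOn_duhamel_le hg hm htt k (π * n)) (hFs t)
  rw [intervalIntegral.integral_const_mul] at hmono
  refine hmono.trans (mul_le_mul_of_nonneg_left ?_ (by norm_num))
  exact hasSum_le hint hFi (haJ.mul_right _)

lemma weight_mul_inv_le_two (k : ℝ) (hk : k ≠ 0) :
    (|k| + |k| ^ 2) * (π / (|k| * √(1 + k ^ 2))) ≤ 2 * π := by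
  have hk' : 0 < |k| := abs_pos.mpr hk
  have h1 : |k| ≤ √(1 + k ^ 2) := Real.abs_le_sqrt (by linarith)
  have h2 : 1 ≤ √(1 + k ^ 2) := Real.one_le_sqrt.mpr (by nlinarith [sq_nonneg k])
  rw [mul_div_assoc', div_le_iff₀ (by positivity)]
  have : 0 ≤ |k| * π * (2 * √(1 + k ^ 2) - 1 - |k|) :=
    mul_nonneg (by positivity) (by linarith)
  linarith

/-- The space-time estimate for jointly continuous data on the whole plane. -/
lemma spacetime_estimate_of_continuous {k l t₀ t₁ : ℝ} {g gy p p' : ℝ → ℝ → ℂ} (hk : k ≠ 0)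
    (hkl : k ≠ l) (ht : t₀ ≤ t₁) (hg : Continuous (Function.uncurry g))
    (hgy : Continuous (Function.uncurry gy))
    (hgd : ∀ t ∈ Icc t₀ t₁, ∀ y ∈ Ioo (-1 : ℝ) 1, HasDerivAt (g t) (gy t y) y)
    (hgbd : ∀ t ∈ Icc t₀ t₁, g t (-1) = 0 ∧ g t 1 = 0)
    (hp : Continuous (Function.uncurry p)) (hp' : Continuous (Function.uncurry p'))
    (hd : ∀ t ∈ Icc t₀ t₁, ∀ y ∈ Ioo (-1 : ℝ) 1, HasDerivAt (p t) (p' t y) y)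
    (hd' : ∀ t ∈ Icc t₀ t₁, ∀ y ∈ Ioo (-1 : ℝ) 1,
      HasDerivAt (p' t) ((k : ℂ) ^ 2 * p t y - duhamel g k t₀ t y) y)
    (hbd : ∀ t ∈ Icc t₀ t₁, p t (-1) = 0 ∧ p t 1 = 0) :
    (⨆ t : Icc t₀ t₁, L2sq (duhamel g k t₀ t)) +
        (|k| + |k| ^ 2) * ∫ t in t₀..t₁, (L2sq (p' t) + k ^ 2 * L2sq (p t))
      ≤ π * (1 + 10 * π) * |k - l|⁻¹ * (1 + |k - l| ^ 2) ^ (-(1 : ℝ) / 2)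
        * sourceEnergy g gy k l t₀ t₁ := by
  have hm : k - l ≠ 0 := sub_ne_zero.mpr hkl
  have hS := sum_characteristicEnergy_le (k := k) (l := l) ht hg hgy hgd hgbd
  have hJ := (summable_of_sum_le (fun n : ℤ => characteristicEnergy_nonneg g k (k - l) (π * n) ht)
    hS).hasSum
  set J := ∑' n : ℤ, characteristicEnergy g k (k - l) t₀ t₁ (π * n) with hJdef
  set R := sourceEnergy g gy k l t₀ t₁
  have hJR : J ≤ 2 * R := hasSum_le_of_sum_le hJ hS
  set B := π / (|k - l| * √(1 + (k - l) ^ 2)) with hB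
  have hB0 : 0 < B := by positivity
  have hBJ : B * J ≤ B * (2 * R) := mul_le_mul_of_nonneg_left hJR hB0.le
  have hsup : (⨆ t : Icc t₀ t₁, L2sq (duhamel g k t₀ t)) ≤ B * R := by
    have : Nonempty (Icc t₀ t₁) := ⟨⟨t₀, left_mem_Icc.mpr ht⟩⟩
    refine ciSup_le fun t => ?_
    have := two_mul_L2sq_duhamel_le hg hm t.2 hJ
    linarith
  have hint := integral_stream_energy_le hg hk hm ht hJ hp hp' hd hd' hbd
  have hBJ0 : 0 ≤ B * J :=
    mul_nonneg hB0.le (hJ.nonneg fun n : ℤ => characteristicEnergy_nonneg g k (k - l) (π * n) ht)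
  have hstream : (|k| + |k| ^ 2) * ∫ t in t₀..t₁, (L2sq (p' t) + k ^ 2 * L2sq (p t))
      ≤ 10 * π * (B * R) := by
    have h1 := mul_le_mul_of_nonneg_left hint (by positivity : 0 ≤ |k| + |k| ^ 2)
    have h2 := mul_le_mul_of_nonneg_left (weight_mul_inv_le_two k hk)
      (by positivity : 0 ≤ 5 / 2 * (B * J))
    have h3 := mul_le_mul_of_nonneg_left hBJ (by positivity : 0 ≤ 5 * π)
    linarith
  have e : π * (1 + 10 * π) * |k - l|⁻¹ * (1 + |k - l| ^ 2) ^ (-(1 : ℝ) / 2) * R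
      = B * R + 10 * π * (B * R) := by
    have : (1 + |k - l| ^ 2) ^ (-(1 : ℝ) / 2) = (√(1 + (k - l) ^ 2))⁻¹ := by
      rw [sq_abs, neg_div, Real.rpow_neg (by positivity), Real.sqrt_eq_rpow]
    rw [this, hB]
    ring
  rw [e]
  exact add_le_add hsup hstream

/-- Space-time estimate for the inviscid transport equation `∂_t f + iky f = g`,
`f(t₀) = 0`, and its stream function `ψ = −(∂²_y − k²)^{-1} f`. -/
theorem inviscid_spacetime_estimate :
    ∃ C > (0 : ℝ), ∀ (k l t₀ t₁ : ℝ) (g gy f ψ ψy ψyy : ℝ → ℝ → ℂ),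
      k ≠ 0 → l ≠ 0 → k ≠ l → t₀ < t₁ →
      -- regularity of g
      ContinuousOn (fun p : ℝ × ℝ => g p.1 p.2) (Icc t₀ t₁ ×ˢ Icc (-1) 1) →
      ContinuousOn (fun p : ℝ × ℝ => gy p.1 p.2) (Icc t₀ t₁ ×ˢ Icc (-1) 1) →
      (∀ t ∈ Icc t₀ t₁, ∀ y ∈ Icc (-1 : ℝ) 1,
        HasDerivAt (fun z => g t z) (gy t y) y) →
      (∀ t ∈ Icc t₀ t₁, g t (-1) = 0 ∧ g t 1 = 0) →
      -- f is the solution of ∂_t f + iky f = g with f(t₀,·)=0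
      (∀ t y : ℝ, f t y =
        ∫ τ in t₀..t, Complex.exp (-Complex.I * (k : ℂ) * (y : ℂ) * ((t : ℂ) - (τ : ℂ)))
          * g τ y) →
      -- ψ = −(∂²_y − k²)^{-1} f with Dirichlet boundary conditions
      ContinuousOn (fun p : ℝ × ℝ => ψ p.1 p.2) (Icc t₀ t₁ ×ˢ Icc (-1) 1) →
      ContinuousOn (fun p : ℝ × ℝ => ψy p.1 p.2) (Icc t₀ t₁ ×ˢ Icc (-1) 1) →
      (∀ t ∈ Icc t₀ t₁, ∀ y ∈ Icc (-1 : ℝ) 1,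
        HasDerivAt (fun z => ψ t z) (ψy t y) y) →
      (∀ t ∈ Icc t₀ t₁, ∀ y ∈ Icc (-1 : ℝ) 1,
        HasDerivAt (fun z => ψy t z) (ψyy t y) y) →
      (∀ t ∈ Icc t₀ t₁, ψ t (-1) = 0 ∧ ψ t 1 = 0) →
      (∀ t ∈ Icc t₀ t₁, ∀ y ∈ Ioo (-1 : ℝ) 1,
        ψyy t y - (k : ℂ) ^ 2 * ψ t y = -f t y) →
      -- conclusion
      (⨆ t : Icc t₀ t₁, L2sq (f t)) +
        (|k| + |k| ^ 2) *
          ∫ t in t₀..t₁, (L2sq (ψy t) + k ^ 2 * L2sq (ψ t))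
      ≤ C * |k - l|⁻¹ * (1 + |k - l| ^ 2) ^ (-(1 : ℝ) / 2) *
          ∫ t in t₀..t₁,
            (L2sq (fun y => Complex.exp (Complex.I * (l : ℂ) * (y : ℂ) * (t : ℂ))
                * (gy t y + Complex.I * (l : ℂ) * (t : ℂ) * g t y))
              + (1 + |k - l| ^ 2) * L2sq (g t)) := by
  refine ⟨π * (1 + 10 * π), by positivity, ?_⟩
  intro k l t₀ t₁ g gy f ψ ψy ψyy hk _ hkl ht hg hgy hgd hgbd hf hψ hψy hψd hψyd hψbd hode
  have hI : (-1 : ℝ) ≤ 1 := by norm_num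
  obtain ⟨G, hG, hGe⟩ := exists_continuous_extension ht.le hI hg
  obtain ⟨Gy, hGy, hGye⟩ := exists_continuous_extension ht.le hI hgy
  obtain ⟨P, hP, hPe⟩ := exists_continuous_extension ht.le hI hψ
  obtain ⟨P', hP', hPe'⟩ := exists_continuous_extension ht.le hI hψy
  have hm1 : (-1 : ℝ) ∈ Icc (-1 : ℝ) 1 := left_mem_Icc.mpr hI
  have h1 : (1 : ℝ) ∈ Icc (-1 : ℝ) 1 := right_mem_Icc.mpr hI
  have hfe : ∀ t ∈ Icc t₀ t₁, ∀ y ∈ Icc (-1 : ℝ) 1, duhamel G k t₀ t y = f t y := by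
    intro t htt y hy
    rw [hf, duhamel]
    refine intervalIntegral.integral_congr fun τ hτ => ?_
    rw [uIcc_of_le htt.1] at hτ
    simp only [hGe τ ⟨hτ.1, hτ.2.trans htt.2⟩ y hy]
  have hext : ∀ {u v : ℝ → ℂ} {v' : ℂ} {y : ℝ}, (∀ z ∈ Icc (-1 : ℝ) 1, u z = v z) →
      y ∈ Ioo (-1 : ℝ) 1 → HasDerivAt v v' y → HasDerivAt u v' y := fun huv hy hv =>
    hv.congr_of_eventuallyEq (Filter.eventually_of_mem (isOpen_Ioo.mem_nhds hy)
      fun z hz => huv z (Ioo_subset_Icc_self hz))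
  have H := spacetime_estimate_of_continuous (g := G) (gy := Gy) (p := P) (p' := P') hk hkl ht.le
    hG hGy
    (fun t htt y hy => by
      rw [hGye t htt y (Ioo_subset_Icc_self hy)]
      exact hext (hGe t htt) hy (hgd t htt y (Ioo_subset_Icc_self hy)))
    (fun t htt => by
      rw [hGe t htt _ hm1, hGe t htt _ h1]
      exact hgbd t htt)
    hP hP'
    (fun t htt y hy => by
      rw [hPe' t htt y (Ioo_subset_Icc_self hy)]
      exact hext (hPe t htt) hy (hψd t htt y (Ioo_subset_Icc_self hy)))
    (fun t htt y hy => by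
      have hyc := Ioo_subset_Icc_self hy
      rw [hPe t htt y hyc, hfe t htt y hyc]
      refine hext (hPe' t htt) hy ((hψyd t htt y hyc).congr_deriv ?_)
      linear_combination hode t htt y hy)
    (fun t htt => by
      rw [hPe t htt _ hm1, hPe t htt _ h1]
      exact hψbd t htt)
  have hcongr : ∀ {u v : ℝ → ℝ}, (∀ t ∈ Icc t₀ t₁, u t = v t) →
      ∫ t in t₀..t₁, u t = ∫ t in t₀..t₁, v t := fun huv =>
    intervalIntegral.integral_congr fun t htt => huv t (by rwa [uIcc_of_le ht.le] at htt)
  have hsup : (⨆ t : Icc t₀ t₁, L2sq (duhamel G k t₀ t)) = ⨆ t : Icc t₀ t₁, L2sq (f t) :=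
    iSup_congr fun t => L2sq_congr fun y hy => by rw [hfe t t.2 y hy]
  have hE : ∫ t in t₀..t₁, (L2sq (P' t) + k ^ 2 * L2sq (P t))
      = ∫ t in t₀..t₁, (L2sq (ψy t) + k ^ 2 * L2sq (ψ t)) := hcongr fun t htt => by
    rw [L2sq_congr fun y hy => congrArg norm (hPe' t htt y hy),
      L2sq_congr fun y hy => congrArg norm (hPe t htt y hy)]
  rw [hsup, hE] at H
  refine H.trans_eq (congrArg _ (hcongr fun t htt => ?_))
  congr 1
  · exact L2sq_congr fun y hy => by rw [hGe t htt y hy, hGye t htt y hy]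
  · rw [L2sq_congr fun y hy => congrArg norm (hGe t htt y hy)]
end

section
/- There is a universal constant C > 0 such that: for every k ∈ ℝ with 0 < |k| ≤ 1, every t ≥ 0, and all functions ψ, w : [−1,1] → ℂ with ψ three times continuously differentiable, w three times continuously differentiable, ψ(±1) = 0, w(±1) = 0, and ψ''(y) − k² ψ(y) = −w(y) on (−1,1), one has ‖ψ' + i k t ψ‖_{L²} ≤ C (1 + |k t|)^{−2} ( ‖(e_{k,t} w)'''‖²_{L²} + ‖(e_{k,t} w)''‖²_{L²} + ‖(e_{k,t} w)'‖²_{L²} + ‖w‖²_{L²} )^{1/2}, where e_{k,t}(y) = e^{i k y t} and derivatives of e_{k,t} w are taken in y. -/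
open Set

/-- The function `y ↦ e^{ikyt} w(y)`. -/
noncomputable def ew (k t : ℝ) (w : ℝ → ℂ) : ℝ → ℂ :=
  fun y => Complex.exp (Complex.I * (k : ℂ) * (y : ℂ) * (t : ℂ)) * w y

open MeasureTheory

namespace LowFreq

lemma integral_le_of_pointwise {h p q m : ℝ → ℝ} (hh : Continuous h) (hp : Continuous p)
    (hq : Continuous q) (hm : Continuous m) (a b c d : ℝ)
    (H : ∀ y ∈ Ioo (-1 : ℝ) 1, h y ≤ a * p y + b * q y + c * m y + d) :
    ∫ y in (-1 : ℝ)..1, h y ≤ a * (∫ y in (-1 : ℝ)..1, p y) + b * (∫ y in (-1 : ℝ)..1, q y)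
      + c * (∫ y in (-1 : ℝ)..1, m y) + 2 * d := by
  have hp' : IntervalIntegrable (fun y => a * p y) volume (-1) 1 :=
    (hp.const_mul a).intervalIntegrable _ _
  have hq' : IntervalIntegrable (fun y => b * q y) volume (-1) 1 :=
    (hq.const_mul b).intervalIntegrable _ _
  have hm' : IntervalIntegrable (fun y => c * m y) volume (-1) 1 :=
    (hm.const_mul c).intervalIntegrable _ _
  have hd : IntervalIntegrable (fun _ : ℝ => d) volume (-1) 1 :=
    continuous_const.intervalIntegrable _ _
  have h1 : ∫ y in (-1 : ℝ)..1, h y ≤ ∫ y in (-1 : ℝ)..1, (a * p y + b * q y + c * m y + d) :=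
    intervalIntegral.integral_mono_on_of_le_Ioo (by norm_num) (hh.intervalIntegrable _ _)
      (((hp'.add hq').add hm').add hd) H
  rw [intervalIntegral.integral_add ((hp'.add hq').add hm') hd,
    intervalIntegral.integral_add (hp'.add hq') hm', intervalIntegral.integral_add hp' hq'] at h1
  simp only [intervalIntegral.integral_const_mul, intervalIntegral.integral_const, smul_eq_mul]
    at h1
  linarith

lemma integral_weighted_normSq_deriv {g g1 : ℝ → ℂ} (hg : ∀ y, HasDerivAt g (g1 y) y)
    (hg1 : Continuous g1) :
    ∫ y in (-1 : ℝ)..1, (‖g y‖ ^ 2 + y * (2 * inner ℝ (g y) (g1 y)))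
      = ‖g 1‖ ^ 2 + ‖g (-1)‖ ^ 2 := by
  have hgc : Continuous g := continuous_iff_continuousAt.2 fun y => (hg y).continuousAt
  rw [intervalIntegral.integral_eq_sub_of_hasDerivAt (f := fun y => y * ‖g y‖ ^ 2)]
  · ring
  · intro y _
    exact ((hasDerivAt_id y).mul (hg y).norm_sq).congr_deriv (by simp)
  · exact Continuous.intervalIntegrable (by fun_prop) _ _

lemma weighted_inner_le {z z1 : ℂ} {y : ℝ} (hy : y ∈ Ioo (-1 : ℝ) 1) :
    |y * (2 * inner ℝ z z1)| ≤ 2 * (‖z‖ * ‖z1‖) := by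
  have h1 := abs_real_inner_le_norm z z1
  have h2 : |y| ≤ 1 := abs_le.2 ⟨hy.1.le, hy.2.le⟩
  rw [abs_mul, abs_mul, abs_two]
  have := mul_le_mul h2 (mul_le_mul_of_nonneg_left h1 (zero_le_two (α := ℝ)))
    (by positivity) zero_le_one
  linarith

lemma trace_le {g g1 : ℝ → ℂ} (hg : ∀ y, HasDerivAt g (g1 y) y) (hg1 : Continuous g1) :
    ‖g 1‖ ^ 2 + ‖g (-1)‖ ^ 2
      ≤ 2 * (∫ y in (-1 : ℝ)..1, ‖g y‖ ^ 2) + ∫ y in (-1 : ℝ)..1, ‖g1 y‖ ^ 2 := by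
  have hgc : Continuous g := continuous_iff_continuousAt.2 fun y => (hg y).continuousAt
  rw [← integral_weighted_normSq_deriv hg hg1]
  have := integral_le_of_pointwise (h := fun y => ‖g y‖ ^ 2 + y * (2 * inner ℝ (g y) (g1 y)))
    (p := fun y => ‖g y‖ ^ 2) (q := fun y => ‖g1 y‖ ^ 2) (m := fun _ => 0)
    (by fun_prop) (by fun_prop) (by fun_prop) (by fun_prop) 2 1 0 0 (by
      intro y hy
      have := (abs_le.1 (weighted_inner_le (z := g y) (z1 := g1 y) hy)).2
      nlinarith [sq_nonneg (‖g y‖ - ‖g1 y‖)])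
  linarith

lemma poincare {g g1 : ℝ → ℂ} (hg : ∀ y, HasDerivAt g (g1 y) y) (hg1 : Continuous g1)
    (hl : g (-1) = 0) (hr : g 1 = 0) :
    ∫ y in (-1 : ℝ)..1, ‖g y‖ ^ 2 ≤ 4 * ∫ y in (-1 : ℝ)..1, ‖g1 y‖ ^ 2 := by
  have hgc : Continuous g := continuous_iff_continuousAt.2 fun y => (hg y).continuousAt
  have h0 := integral_weighted_normSq_deriv hg hg1
  have := integral_le_of_pointwise (h := fun y => ‖g y‖ ^ 2)
    (p := fun y => ‖g y‖ ^ 2) (q := fun y => ‖g1 y‖ ^ 2)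
    (m := fun y => ‖g y‖ ^ 2 + y * (2 * inner ℝ (g y) (g1 y)))
    (by fun_prop) (by fun_prop) (by fun_prop) (by fun_prop) (1 / 2) 2 1 0 (by
      intro y hy
      have := (abs_le.1 (weighted_inner_le (z := g y) (z1 := g1 y) hy)).1
      nlinarith [sq_nonneg (‖g y‖ - 2 * ‖g1 y‖)])
  rw [h0, hl, hr, norm_zero] at this
  linarith

/-- Energy estimate for the Dirichlet problem of `∂² - k²` with source `∂Q + R`. -/
lemma energy_le {k : ℝ} {θ θ1 θ2 Q Q1 R : ℝ → ℂ} (hθ : ∀ y, HasDerivAt θ (θ1 y) y)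
    (hθ1 : ∀ y, HasDerivAt θ1 (θ2 y) y) (hθ2 : Continuous θ2)
    (hQ : ∀ y, HasDerivAt Q (Q1 y) y) (hQ1 : Continuous Q1) (hR : Continuous R)
    (hl : θ (-1) = 0) (hr : θ 1 = 0)
    (heq : ∀ y ∈ Ioo (-1 : ℝ) 1, θ2 y - (k : ℂ) ^ 2 * θ y = Q1 y + R y) :
    ∫ y in (-1 : ℝ)..1, ‖θ1 y‖ ^ 2
      ≤ 2 * (∫ y in (-1 : ℝ)..1, ‖Q y‖ ^ 2) + 8 * ∫ y in (-1 : ℝ)..1, ‖R y‖ ^ 2 := by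
  have hc : Continuous θ := continuous_iff_continuousAt.2 fun y => (hθ y).continuousAt
  have hc1 : Continuous θ1 := continuous_iff_continuousAt.2 fun y => (hθ1 y).continuousAt
  have hcQ : Continuous Q := continuous_iff_continuousAt.2 fun y => (hQ y).continuousAt
  have h0 : ∫ y in (-1 : ℝ)..1, (inner ℝ (θ y) (θ2 y - Q1 y) + inner ℝ (θ1 y) (θ1 y - Q y))
      = 0 := by
    rw [intervalIntegral.integral_eq_sub_of_hasDerivAt
      (f := fun y => inner ℝ (θ y) (θ1 y - Q y))]
    · simp [hl, hr]
    · intro y _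
      exact (hθ y).inner ℝ ((hθ1 y).sub (hQ y))
    · exact Continuous.intervalIntegrable (by fun_prop) _ _
  have hp := poincare hθ hc1 hl hr
  have := integral_le_of_pointwise
    (h := fun y => ‖θ1 y‖ ^ 2 -
      (inner ℝ (θ y) (θ2 y - Q1 y) + inner ℝ (θ1 y) (θ1 y - Q y)) - ‖θ1 y‖ ^ 2 / 4)
    (p := fun y => ‖θ y‖ ^ 2) (q := fun y => ‖Q y‖ ^ 2) (m := fun y => ‖R y‖ ^ 2)
    (by fun_prop) (by fun_prop) (by fun_prop) (by fun_prop) (1 / 16) 1 4 0 (by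
      intro y hy
      have e1 : θ2 y - Q1 y = (k ^ 2 : ℝ) • θ y + R y := by
        rw [Complex.real_smul]; push_cast; linear_combination heq y hy
      rw [e1, inner_add_right, inner_sub_right, inner_smul_right, real_inner_self_eq_norm_sq,
        real_inner_self_eq_norm_sq]
      have h1 := (abs_le.1 (abs_real_inner_le_norm (θ y) (R y))).1
      have h2 := (abs_le.1 (abs_real_inner_le_norm (θ1 y) (Q y))).2
      have h3 : 0 ≤ k ^ 2 * ‖θ y‖ ^ 2 := by positivity
      nlinarith [sq_nonneg (‖θ1 y‖ - 2 * ‖Q y‖), sq_nonneg (‖θ y‖ - 8 * ‖R y‖)])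
  rw [intervalIntegral.integral_sub, intervalIntegral.integral_sub, h0,
    intervalIntegral.integral_div] at this
  · linarith
  all_goals exact Continuous.intervalIntegrable (by fun_prop) _ _

/-- The oscillating factor `y ↦ e^{-isy}`. -/
noncomputable def osc (s y : ℝ) : ℂ := Complex.exp (-(Complex.I * s * y))

lemma norm_osc (s y : ℝ) : ‖osc s y‖ = 1 := by
  rw [osc, show -(Complex.I * s * y) = ((-(s * y) : ℝ) : ℂ) * Complex.I by push_cast; ring]
  exact Complex.norm_exp_ofReal_mul_I _

lemma hasDerivAt_osc (s y : ℝ) : HasDerivAt (osc s) (-(Complex.I * s) * osc s y) y := by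
  have h : HasDerivAt (fun y : ℝ => -(Complex.I * s * (y : ℂ))) (-(Complex.I * s)) y := by
    exact ((Complex.ofRealCLM.hasDerivAt (x := y)).const_mul (Complex.I * s)).neg.congr_deriv
      (by simp)
  exact h.cexp.congr_deriv (mul_comm _ _)

lemma hasDerivAt_osc_mul {s y : ℝ} {f : ℝ → ℂ} {f' : ℂ} (hf : HasDerivAt f f' y) :
    HasDerivAt (fun y => osc s y * f y) (osc s y * (f' - Complex.I * s * f y)) y := by
  exact ((hasDerivAt_osc s y).mul hf).congr_deriv (by ring)

lemma continuous_osc (s : ℝ) : Continuous (osc s) := by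
  unfold osc; fun_prop

lemma low_bound {k s : ℝ} (hs : |s| ≤ 1) {ψ ψ1 ψ2 w : ℝ → ℂ}
    (hψ : ∀ y, HasDerivAt ψ (ψ1 y) y) (hψ1 : ∀ y, HasDerivAt ψ1 (ψ2 y) y)
    (hψ2 : Continuous ψ2) (hw : Continuous w) (hl : ψ (-1) = 0) (hr : ψ 1 = 0)
    (heq : ∀ y ∈ Ioo (-1 : ℝ) 1, ψ2 y - (k : ℂ) ^ 2 * ψ y = -w y) :
    ∫ y in (-1 : ℝ)..1, ‖ψ1 y + Complex.I * s * ψ y‖ ^ 2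
      ≤ 80 * ∫ y in (-1 : ℝ)..1, ‖w y‖ ^ 2 := by
  have hc : Continuous ψ := continuous_iff_continuousAt.2 fun y => (hψ y).continuousAt
  have hc1 : Continuous ψ1 := continuous_iff_continuousAt.2 fun y => (hψ1 y).continuousAt
  have h1 := energy_le (Q := fun _ => 0) (Q1 := fun _ => 0) (R := fun y => -w y) hψ hψ1 hψ2
    (fun y => hasDerivAt_const y 0) continuous_const hw.neg hl hr (by simpa using heq)
  have h2 := poincare hψ hc1 hl hr
  have h3 := integral_le_of_pointwise (h := fun y => ‖ψ1 y + Complex.I * s * ψ y‖ ^ 2)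
    (p := fun y => ‖ψ1 y‖ ^ 2) (q := fun y => ‖ψ y‖ ^ 2) (m := fun _ => 0)
    (by fun_prop) (by fun_prop) (by fun_prop) (by fun_prop) 2 2 0 0 (by
      intro y _
      have a1 : ‖ψ1 y + Complex.I * s * ψ y‖ ≤ ‖ψ1 y‖ + ‖ψ y‖ := by
        refine (norm_add_le _ _).trans ?_
        gcongr
        rw [norm_mul, norm_mul, Complex.norm_I, one_mul, Complex.norm_real, Real.norm_eq_abs]
        exact mul_le_of_le_one_left (norm_nonneg _) hs
      have a2 := pow_le_pow_left₀ (norm_nonneg _) a1 2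
      nlinarith [sq_nonneg (‖ψ1 y‖ - ‖ψ y‖)])
  simp only [norm_neg, norm_zero, ne_eq, OfNat.ofNat_ne_zero, not_false_eq_true, zero_pow,
    intervalIntegral.integral_zero] at h1 h3
  linarith

lemma norm_half_add_sq_le {u v : ℂ} : ‖(u + v) / 2‖ ^ 2 ≤ (‖u‖ ^ 2 + ‖v‖ ^ 2) / 2 := by
  have h := pow_le_pow_left₀ (norm_nonneg _) (norm_add_le u v) 2
  rw [norm_div, div_pow, Complex.norm_two]
  nlinarith [sq_nonneg (‖u‖ - ‖v‖)]

set_option maxHeartbeats 1000000 in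
lemma high_bound {k s : ℝ} (hk : |k| ≤ 1) (hs : 1 ≤ |s|) {ψ ψ1 ψ2 f0 f1 f2 f3 : ℝ → ℂ}
    (hψ : ∀ y, HasDerivAt ψ (ψ1 y) y) (hψ1 : ∀ y, HasDerivAt ψ1 (ψ2 y) y)
    (hψ2 : Continuous ψ2) (hf0 : ∀ y, HasDerivAt f0 (f1 y) y)
    (hf1 : ∀ y, HasDerivAt f1 (f2 y) y) (hf2 : ∀ y, HasDerivAt f2 (f3 y) y)
    (hf3 : Continuous f3) (hl : ψ (-1) = 0) (hr : ψ 1 = 0) (hfl : f0 (-1) = 0) (hfr : f0 1 = 0)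
    (heq : ∀ y ∈ Ioo (-1 : ℝ) 1, ψ2 y - (k : ℂ) ^ 2 * ψ y = -(osc s y * f0 y)) :
    ∫ y in (-1 : ℝ)..1, ‖ψ1 y + Complex.I * s * ψ y‖ ^ 2
      ≤ 100000 * (s⁻¹) ^ 4 *
        ∫ y in (-1 : ℝ)..1, (‖f3 y‖ ^ 2 + ‖f2 y‖ ^ 2 + ‖f1 y‖ ^ 2 + ‖f0 y‖ ^ 2) := by
  have hs0 : s ≠ 0 := by rintro rfl; norm_num at hs
  have hsC : (s : ℂ) ≠ 0 := by exact_mod_cast hs0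
  have hc : Continuous ψ := continuous_iff_continuousAt.2 fun y => (hψ y).continuousAt
  have hc1 : Continuous ψ1 := continuous_iff_continuousAt.2 fun y => (hψ1 y).continuousAt
  have hcf0 : Continuous f0 := continuous_iff_continuousAt.2 fun y => (hf0 y).continuousAt
  have hcf1 : Continuous f1 := continuous_iff_continuousAt.2 fun y => (hf1 y).continuousAt
  have hcf2 : Continuous f2 := continuous_iff_continuousAt.2 fun y => (hf2 y).continuousAt
  have hosc := continuous_osc s
  set M : ℝ → ℝ := fun y => ‖f3 y‖ ^ 2 + ‖f2 y‖ ^ 2 + ‖f1 y‖ ^ 2 + ‖f0 y‖ ^ 2 with hM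
  have hMc : Continuous M := by fun_prop
  set N := ∫ y in (-1 : ℝ)..1, M y with hN
  obtain ⟨c, hcdef⟩ : ∃ c : ℝ, c = s⁻¹ := ⟨_, rfl⟩
  rw [← hcdef]
  have hcsR : c * s = 1 := by rw [hcdef]; field_simp
  have hcle : |c| ≤ 1 := by rw [hcdef, abs_inv]; exact inv_le_one_of_one_le₀ hs
  have hc2 : c ^ 2 ≤ 1 := by rw [← sq_abs]; exact pow_le_one₀ (abs_nonneg _) hcle
  have hk2 : k ^ 2 ≤ 1 := by rw [← sq_abs]; exact pow_le_one₀ (abs_nonneg _) hk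
  obtain ⟨vr, hvr⟩ : ∃ v : ℂ, v = 2 * Complex.I * c ^ 3 * (osc s 1 * f1 1) := ⟨_, rfl⟩
  obtain ⟨vl, hvl⟩ : ∃ v : ℂ, v = 2 * Complex.I * c ^ 3 * (osc s (-1) * f1 (-1)) := ⟨_, rfl⟩
  obtain ⟨α, hα⟩ : ∃ v : ℂ, v = (vr + vl) / 2 := ⟨_, rfl⟩
  obtain ⟨β, hβ⟩ : ∃ v : ℂ, v = (vr + -vl) / 2 := ⟨_, rfl⟩
  have hvnorm : ‖vr‖ ^ 2 + ‖vl‖ ^ 2 ≤ 8 * c ^ 6 * N := by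
    have ht := trace_le hf1 hcf2
    have h1 : ‖vr‖ ^ 2 = 4 * c ^ 6 * ‖f1 1‖ ^ 2 := by
      rw [hvr]
      simp only [norm_mul, norm_osc, Complex.norm_I, norm_pow, Complex.norm_real,
        Complex.norm_two, Real.norm_eq_abs, mul_pow]
      rw [← pow_mul, Even.pow_abs (by decide)]
      ring
    have h2 : ‖vl‖ ^ 2 = 4 * c ^ 6 * ‖f1 (-1)‖ ^ 2 := by
      rw [hvl]
      simp only [norm_mul, norm_osc, Complex.norm_I, norm_pow, Complex.norm_real,
        Complex.norm_two, Real.norm_eq_abs, mul_pow]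
      rw [← pow_mul, Even.pow_abs (by decide)]
      ring
    have h3 : ∫ y in (-1 : ℝ)..1, (2 * ‖f1 y‖ ^ 2 + ‖f2 y‖ ^ 2) ≤ 2 * N := by
      have := integral_le_of_pointwise (h := fun y => 2 * ‖f1 y‖ ^ 2 + ‖f2 y‖ ^ 2)
        (p := fun _ => 0) (q := fun _ => 0) (m := M)
        (by fun_prop) (by fun_prop) (by fun_prop) (by fun_prop) 0 0 2 0 (by
          intro y _
          simp only [hM]
          nlinarith [sq_nonneg ‖f0 y‖, sq_nonneg ‖f2 y‖, sq_nonneg ‖f3 y‖])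
      linarith
    rw [intervalIntegral.integral_add (Continuous.intervalIntegrable (by fun_prop) _ _)
      (Continuous.intervalIntegrable (by fun_prop) _ _),
      intervalIntegral.integral_const_mul] at h3
    rw [h1, h2]
    have h4 : 0 ≤ c ^ 6 := by positivity
    nlinarith [mul_le_mul_of_nonneg_left (ht.trans h3) h4]
  have hαn : ‖α‖ ^ 2 ≤ 4 * c ^ 6 * N := by
    rw [hα]; exact norm_half_add_sq_le.trans (by linarith)
  have hβn : ‖β‖ ^ 2 ≤ 4 * c ^ 6 * N := by
    rw [hβ]
    refine norm_half_add_sq_le.trans ?_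
    rw [norm_neg]; linarith
  obtain ⟨θ, hθ⟩ : ∃ θ : ℝ → ℂ, θ = fun y => ψ y - c ^ 2 * (osc s y * f0 y)
    + 2 * Complex.I * c ^ 3 * (osc s y * f1 y) - (α + β * y) := ⟨_, rfl⟩
  obtain ⟨θ1, hθ1⟩ : ∃ θ1 : ℝ → ℂ, θ1 = fun y =>
    ψ1 y - c ^ 2 * (osc s y * (f1 y - Complex.I * s * f0 y))
    + 2 * Complex.I * c ^ 3 * (osc s y * (f2 y - Complex.I * s * f1 y)) - β := ⟨_, rfl⟩
  obtain ⟨θ2, hθ2⟩ : ∃ θ2 : ℝ → ℂ, θ2 = fun y =>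
    ψ2 y - c ^ 2 * (osc s y * ((f2 y - Complex.I * s * f1 y)
        - Complex.I * s * (f1 y - Complex.I * s * f0 y)))
    + 2 * Complex.I * c ^ 3 * (osc s y * ((f3 y - Complex.I * s * f2 y)
        - Complex.I * s * (f2 y - Complex.I * s * f1 y))) := ⟨_, rfl⟩
  obtain ⟨Q, hQ⟩ : ∃ Q : ℝ → ℂ, Q = fun y =>
    Complex.I * c ^ 3 * (osc s y * (3 * f2 y + k ^ 2 * f0 y)) := ⟨_, rfl⟩
  obtain ⟨Q1, hQ1⟩ : ∃ Q1 : ℝ → ℂ, Q1 = fun y =>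
    Complex.I * c ^ 3 * (osc s y * ((3 * f3 y + k ^ 2 * f1 y)
      - Complex.I * s * (3 * f2 y + k ^ 2 * f0 y))) := ⟨_, rfl⟩
  obtain ⟨R, hR⟩ : ∃ R : ℝ → ℂ, R = fun y =>
    -(Complex.I * c ^ 3 * (osc s y * f3 y)) - 3 * Complex.I * k ^ 2 * c ^ 3 * (osc s y * f1 y)
      + k ^ 2 * (α + β * y) := ⟨_, rfl⟩
  have hlin : ∀ y : ℝ, HasDerivAt (fun y : ℝ => α + β * (y : ℂ)) β y := fun y => by
    simpa using ((Complex.ofRealCLM.hasDerivAt (x := y)).const_mul β).const_add α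
  have dθ : ∀ y, HasDerivAt θ (θ1 y) y := fun y => by
    rw [hθ, hθ1]
    exact (((hψ y).sub ((hasDerivAt_osc_mul (hf0 y)).const_mul _)).add
      ((hasDerivAt_osc_mul (hf1 y)).const_mul _)).sub (hlin y)
  have dθ1 : ∀ y, HasDerivAt θ1 (θ2 y) y := fun y => by
    rw [hθ1, hθ2]
    exact (((hψ1 y).sub ((hasDerivAt_osc_mul ((hf1 y).sub ((hf0 y).const_mul _))).const_mul _)).add
      ((hasDerivAt_osc_mul ((hf2 y).sub ((hf1 y).const_mul _))).const_mul _)).sub_const _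
  have dQ : ∀ y, HasDerivAt Q (Q1 y) y := fun y => by
    rw [hQ, hQ1]
    exact (hasDerivAt_osc_mul (((hf2 y).const_mul _).add ((hf0 y).const_mul _))).const_mul _
  have cθ : Continuous θ := continuous_iff_continuousAt.2 fun y => (dθ y).continuousAt
  have cθ1 : Continuous θ1 := continuous_iff_continuousAt.2 fun y => (dθ1 y).continuousAt
  have cθ2 : Continuous θ2 := by rw [hθ2]; fun_prop
  have cQ : Continuous Q := by rw [hQ]; fun_prop
  have cQ1 : Continuous Q1 := by rw [hQ1]; fun_prop
  have cR : Continuous R := by rw [hR]; fun_prop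
  have hθl : θ (-1) = 0 := by
    simp only [hθ, hl, hfl]; push_cast; rw [hα, hβ]; linear_combination -hvl
  have hθr : θ 1 = 0 := by
    simp only [hθ, hr, hfr]; push_cast; rw [hα, hβ]; linear_combination -hvr
  have hθeq : ∀ y ∈ Ioo (-1 : ℝ) 1, θ2 y - (k : ℂ) ^ 2 * θ y = Q1 y + R y := by
    intro y hy
    have h := heq y hy
    have h2 : (c : ℂ) = (s : ℂ)⁻¹ := by rw [hcdef]; push_cast; rfl
    have hψe : ψ2 y = (k : ℂ) ^ 2 * ψ y - osc s y * f0 y := by linear_combination h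
    simp only [hθ, hθ2, hQ1, hR, hψe]
    rw [h2]
    field_simp
    ring_nf
    simp only [Complex.I_sq, show Complex.I ^ 3 = -Complex.I from Complex.I_pow_three]
    ring
  have hE := energy_le dθ dθ1 cθ2 dQ cQ1 cR hθl hθr hθeq
  have hP := poincare dθ cθ1 hθl hθr
  have hk2n : ∀ z : ℂ, ‖(k : ℂ) ^ 2 * z‖ ≤ ‖z‖ := fun z => by
    rw [norm_mul, norm_pow, Complex.norm_real, Real.norm_eq_abs, sq_abs]
    exact mul_le_of_le_one_left (norm_nonneg _) hk2
  have hyn : ∀ y ∈ Ioo (-1 : ℝ) 1, ‖α + β * y‖ ≤ ‖α‖ + ‖β‖ := fun y hy => by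
    refine (norm_add_le _ _).trans ?_
    gcongr
    rw [norm_mul, Complex.norm_real]
    exact mul_le_of_le_one_right (norm_nonneg _) (abs_le.2 ⟨hy.1.le, hy.2.le⟩)
  obtain ⟨p, hp⟩ : ∃ p : ℝ, p = |c| ^ 3 := ⟨_, rfl⟩
  have hp0 : 0 ≤ p := by rw [hp]; positivity
  have hp2 : p ^ 2 = c ^ 6 := by
    rw [hp, ← pow_mul, Even.pow_abs (by decide)]
  have hQn : ∫ y in (-1 : ℝ)..1, ‖Q y‖ ^ 2 ≤ 18 * c ^ 6 * N := by
    have := integral_le_of_pointwise (h := fun y => ‖Q y‖ ^ 2)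
      (p := fun _ => 0) (q := fun _ => 0) (m := M)
      (by fun_prop) (by fun_prop) (by fun_prop) (by fun_prop) 0 0 (18 * c ^ 6) 0 (by
        intro y _
        have h1 : ‖Q y‖ ≤ p * (3 * ‖f2 y‖ + ‖f0 y‖) := by
          rw [hQ]
          simp only [norm_mul, norm_osc, Complex.norm_I, norm_pow, Complex.norm_real,
            Real.norm_eq_abs, one_mul]
          rw [← hp]
          refine mul_le_mul_of_nonneg_left ((norm_add_le _ _).trans ?_) hp0
          refine add_le_add ?_ (hk2n _)
          simp
        have h2 := pow_le_pow_left₀ (norm_nonneg _) h1 2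
        have h3 : (3 * ‖f2 y‖ + ‖f0 y‖) ^ 2 ≤ 18 * M y := by
          simp only [hM]
          nlinarith [sq_nonneg (3 * ‖f2 y‖ - ‖f0 y‖), sq_nonneg ‖f0 y‖, sq_nonneg ‖f1 y‖,
            sq_nonneg ‖f3 y‖]
        rw [mul_pow, hp2] at h2
        have h4 := mul_le_mul_of_nonneg_left h3 (show 0 ≤ c ^ 6 by positivity)
        linarith)
    linarith
  have hRn : ∫ y in (-1 : ℝ)..1, ‖R y‖ ^ 2 ≤ 100 * c ^ 6 * N := by
    have := integral_le_of_pointwise (h := fun y => ‖R y‖ ^ 2)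
      (p := fun _ => 0) (q := fun _ => 0) (m := M)
      (by fun_prop) (by fun_prop) (by fun_prop) (by fun_prop) 0 0 (36 * c ^ 6)
      (32 * c ^ 6 * N) (by
        intro y hy
        have h1 : ‖R y‖ ≤ p * ‖f3 y‖ + 3 * (p * ‖f1 y‖) + (‖α‖ + ‖β‖) := by
          rw [hR]
          refine (norm_add_le _ _).trans (add_le_add ((norm_sub_le _ _).trans
            (add_le_add ?_ ?_)) ((hk2n _).trans (hyn y hy)))
          · simp [norm_osc, hp]
          · rw [show 3 * Complex.I * (k : ℂ) ^ 2 * c ^ 3 * (osc s y * f1 y)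
              = (k : ℂ) ^ 2 * (3 * Complex.I * c ^ 3 * (osc s y * f1 y)) by ring]
            refine (hk2n _).trans (le_of_eq ?_)
            simp [norm_osc, hp]
            ring
        have h2 := pow_le_pow_left₀ (norm_nonneg _) h1 2
        have h3 : (p * ‖f3 y‖ + 3 * (p * ‖f1 y‖) + (‖α‖ + ‖β‖)) ^ 2
            ≤ 4 * ((p * ‖f3 y‖) ^ 2 + 9 * (p * ‖f1 y‖) ^ 2 + ‖α‖ ^ 2 + ‖β‖ ^ 2) := by
          nlinarith [sq_nonneg (p * ‖f3 y‖ - 3 * (p * ‖f1 y‖)), sq_nonneg (p * ‖f3 y‖ - ‖α‖),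
            sq_nonneg (p * ‖f3 y‖ - ‖β‖), sq_nonneg (3 * (p * ‖f1 y‖) - ‖α‖),
            sq_nonneg (3 * (p * ‖f1 y‖) - ‖β‖), sq_nonneg (‖α‖ - ‖β‖)]
        have h4 : ‖f3 y‖ ^ 2 + 9 * ‖f1 y‖ ^ 2 ≤ 9 * M y := by
          simp only [hM]
          nlinarith [sq_nonneg ‖f0 y‖, sq_nonneg ‖f2 y‖, sq_nonneg ‖f3 y‖]
        rw [mul_pow, mul_pow, hp2] at h3
        have h5 := mul_le_mul_of_nonneg_left h4 (show 0 ≤ c ^ 6 by positivity)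
        linarith)
    linarith
  have hN0 : 0 ≤ N := intervalIntegral.integral_nonneg (by norm_num) fun y _ => by
    simp only [hM]; positivity
  have hs2 : s ^ 2 * c ^ 6 = c ^ 4 := by
    linear_combination (c ^ 4 * (c * s + 1)) * hcsR
  have hc64 : c ^ 6 ≤ c ^ 4 := by
    have : 0 ≤ c ^ 4 := by positivity
    nlinarith [mul_le_mul_of_nonneg_left hc2 this]
  have hsn : ∀ z : ℂ, ‖Complex.I * s * z‖ = |s| * ‖z‖ := fun z => by simp
  have hfin := integral_le_of_pointwise (h := fun y => ‖ψ1 y + Complex.I * s * ψ y‖ ^ 2)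
    (p := fun y => ‖θ1 y‖ ^ 2) (q := fun y => ‖θ y‖ ^ 2) (m := M)
    (by fun_prop) (by fun_prop) (by fun_prop) (by fun_prop) 7 (7 * s ^ 2) (28 * c ^ 4)
    (7 * (‖β‖ ^ 2 + s ^ 2 * (‖α‖ ^ 2 + ‖β‖ ^ 2))) (by
      intro y hy
      have e : ψ1 y + Complex.I * s * ψ y = θ1 y + Complex.I * s * θ y
          + c ^ 2 * (osc s y * f1 y) - 2 * Complex.I * c ^ 3 * (osc s y * f2 y) + β
          + Complex.I * s * (α + β * y) := by
        simp only [hθ, hθ1]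
        ring
      have h1 : ‖ψ1 y + Complex.I * s * ψ y‖ ≤ ‖θ1 y‖ + |s| * ‖θ y‖ + c ^ 2 * ‖f1 y‖
          + 2 * (p * ‖f2 y‖) + ‖β‖ + |s| * (‖α‖ + ‖β‖) := by
        rw [e]
        refine (norm_add_le _ _).trans (add_le_add ((norm_add_le _ _).trans (add_le_add
          ((norm_sub_le _ _).trans (add_le_add ((norm_add_le _ _).trans (add_le_add
          ((norm_add_le _ _).trans (add_le_add le_rfl (hsn _).le)) ?_)) ?_)) le_rfl)) ?_)
        · simp [norm_osc]
        · simp [norm_osc, hp]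
          exact le_of_eq (by ring)
        · rw [hsn]
          exact mul_le_mul_of_nonneg_left (hyn y hy) (abs_nonneg s)
      have h2 := pow_le_pow_left₀ (norm_nonneg _) h1 2
      have h3 : ∀ a b c d e f g : ℝ, (a + b + c + d + e + (f + g)) ^ 2
          ≤ 7 * (a ^ 2 + b ^ 2 + c ^ 2 + d ^ 2 + e ^ 2 + f ^ 2 + g ^ 2) := by
        intro a b c d e f g
        have := sq_sum_le_card_mul_sum_sq (s := (Finset.univ : Finset (Fin 7)))
          (f := ![a, b, c, d, e, f, g])
        simp [Fin.sum_univ_succ] at this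
        linarith
      rw [mul_add |s|] at h2
      have h4 := h3 ‖θ1 y‖ (|s| * ‖θ y‖) (c ^ 2 * ‖f1 y‖) (2 * (p * ‖f2 y‖)) ‖β‖ (|s| * ‖α‖)
        (|s| * ‖β‖)
      simp only [mul_pow, hp2, sq_abs] at h4
      have h5 : c ^ 4 * ‖f1 y‖ ^ 2 + 4 * c ^ 6 * ‖f2 y‖ ^ 2 ≤ 4 * c ^ 4 * M y := by
        have q1 := mul_le_mul_of_nonneg_right hc64 (sq_nonneg ‖f2 y‖)
        have q2 : 0 ≤ c ^ 4 * (3 * ‖f1 y‖ ^ 2 + 4 * ‖f0 y‖ ^ 2 + 4 * ‖f3 y‖ ^ 2) := by positivity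
        simp only [hM]
        nlinarith
      linarith)
  rw [← hN] at hfin
  have hA : ∫ y in (-1 : ℝ)..1, ‖θ1 y‖ ^ 2 ≤ 836 * c ^ 6 * N := by linarith
  have hB : s ^ 2 * ∫ y in (-1 : ℝ)..1, ‖θ y‖ ^ 2 ≤ 3344 * c ^ 4 * N := by
    have := mul_le_mul_of_nonneg_left (hP.trans (mul_le_mul_of_nonneg_left hA zero_le_four))
      (sq_nonneg s)
    calc _ ≤ _ := this
      _ = 3344 * (s ^ 2 * c ^ 6) * N := by ring
      _ = _ := by rw [hs2]
  have hC : s ^ 2 * (‖α‖ ^ 2 + ‖β‖ ^ 2) ≤ 8 * c ^ 4 * N := by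
    have := mul_le_mul_of_nonneg_left (add_le_add hαn hβn) (sq_nonneg s)
    calc _ ≤ _ := this
      _ = 8 * (s ^ 2 * c ^ 6) * N := by ring
      _ = _ := by rw [hs2]
  have hD := mul_le_mul_of_nonneg_right hc64 hN0
  have hF : 0 ≤ c ^ 4 * N := by positivity
  linarith

lemma hasDerivAt_deriv_of_contDiff {f : ℝ → ℂ} {n : ℕ} (hf : ContDiff ℝ (n + 1 : ℕ) f) :
    (∀ y, HasDerivAt f (deriv f y) y) ∧ ContDiff ℝ n (deriv f) := by
  rw [Nat.cast_succ] at hf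
  exact ⟨fun y => (hf.differentiable (by simp)).differentiableAt.hasDerivAt,
    (contDiff_succ_iff_deriv.1 hf).2.2⟩

lemma sqrt_le_of_le {A B N x : ℝ} (hB : 0 ≤ B) (h : A ≤ B ^ 2 * N)
    (hBx : B ≤ x) : Real.sqrt A ≤ x * Real.sqrt N := by
  refine (Real.sqrt_le_sqrt h).trans ?_
  rw [Real.sqrt_mul (sq_nonneg B), Real.sqrt_sq hB]
  gcongr

end LowFreq

open LowFreq

/-- Low-frequency inviscid damping estimate for `∂_y ψ + ikt ψ`:
`‖∂_y ψ + ikt ψ‖ ≤ C (1+|kt|)^{-2} ‖(∂_y,1)³(e^{ikyt}w)‖` for `0 < |k| ≤ 1`. -/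
theorem psi1_lowfreq_second :
    ∃ C > (0 : ℝ), ∀ (k t : ℝ) (ψ w : ℝ → ℂ),
      k ≠ 0 → |k| ≤ 1 → 0 ≤ t →
      ContDiff ℝ 3 ψ → ContDiff ℝ 3 w →
      ψ (-1) = 0 → ψ 1 = 0 → w (-1) = 0 → w 1 = 0 →
      (∀ y ∈ Ioo (-1 : ℝ) 1, deriv (deriv ψ) y - (k : ℂ) ^ 2 * ψ y = -w y) →
      Real.sqrt (L2sq (fun y => deriv ψ y + Complex.I * (k : ℂ) * (t : ℂ) * ψ y))
        ≤ C * ((1 + |k * t|) ^ 2)⁻¹ * Real.sqrt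
            (L2sq (deriv (deriv (deriv (ew k t w))))
              + L2sq (deriv (deriv (ew k t w)))
              + L2sq (deriv (ew k t w)) + L2sq w) := by
  refine ⟨4000, by norm_num, ?_⟩
  intro k t ψ w _ hk _ hψ hw hψl hψr hwl hwr heq
  obtain ⟨s, hs⟩ : ∃ s : ℝ, s = k * t := ⟨_, rfl⟩
  obtain ⟨dψ, cψ⟩ := hasDerivAt_deriv_of_contDiff (n := 2) hψ
  obtain ⟨dψ1, cψ1⟩ := hasDerivAt_deriv_of_contDiff (n := 1) cψ
  have hf : ContDiff ℝ (2 + 1 : ℕ) (ew k t w) := by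
    have h3 : ContDiff ℝ (2 + 1 : ℕ) w := hw
    have h4 : ContDiff ℝ (2 + 1 : ℕ) (fun y : ℝ => (y : ℂ)) := Complex.ofRealCLM.contDiff
    unfold ew
    exact (((contDiff_const.mul h4).mul contDiff_const).cexp).mul h3
  obtain ⟨d0, c1⟩ := hasDerivAt_deriv_of_contDiff (n := 2) hf
  obtain ⟨d1, c2⟩ := hasDerivAt_deriv_of_contDiff (n := 1) c1
  obtain ⟨d2, c3⟩ := hasDerivAt_deriv_of_contDiff (n := 0) c2
  have hwf : ∀ y, w y = osc s y * ew k t w y := fun y => by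
    rw [osc, ew, ← mul_assoc, ← Complex.exp_add, hs]
    push_cast
    rw [show -(Complex.I * (k * t) * (y : ℂ)) + Complex.I * k * y * t = 0 by ring,
      Complex.exp_zero, one_mul]
  have hw0 : L2sq w = L2sq (ew k t w) := by
    simp only [L2sq]
    congr 1
    ext y
    rw [hwf y, norm_mul, norm_osc, one_mul]
  have hnn : ∀ h : ℝ → ℂ, 0 ≤ L2sq h := fun h =>
    intervalIntegral.integral_nonneg (by norm_num) fun y _ => by positivity
  have hlhs : L2sq (fun y => deriv ψ y + Complex.I * (k : ℂ) * (t : ℂ) * ψ y)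
      = ∫ y in (-1 : ℝ)..1, ‖deriv ψ y + Complex.I * s * ψ y‖ ^ 2 := by
    simp only [L2sq, hs]
    push_cast
    simp only [mul_assoc]
  rw [hlhs, ← hs]
  rcases le_total |s| 1 with h1 | h1
  · have hb := low_bound h1 dψ dψ1 cψ1.continuous hw.continuous hψl hψr heq
    refine sqrt_le_of_le (B := 9) (by norm_num) (hb.trans ?_) ?_
    · change 80 * L2sq w ≤ _
      linarith [hnn w, hnn (deriv (ew k t w)), hnn (deriv (deriv (ew k t w))),
        hnn (deriv (deriv (deriv (ew k t w))))]
    · rw [← div_eq_mul_inv, le_div_iff₀ (by positivity)]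
      nlinarith [abs_nonneg s]
  · have hb := high_bound hk h1 dψ dψ1 cψ1.continuous d0 d1 d2 c3.continuous hψl hψr
      (by simp [ew, hwl]) (by simp [ew, hwr]) (fun y hy => by rw [heq y hy, ← hwf])
    have hN : ∫ y in (-1 : ℝ)..1, (‖deriv (deriv (deriv (ew k t w))) y‖ ^ 2
        + ‖deriv (deriv (ew k t w)) y‖ ^ 2 + ‖deriv (ew k t w) y‖ ^ 2 + ‖ew k t w y‖ ^ 2)
        = L2sq (deriv (deriv (deriv (ew k t w)))) + L2sq (deriv (deriv (ew k t w)))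
          + L2sq (deriv (ew k t w)) + L2sq w := by
      have sq_int : ∀ f : ℝ → ℂ, Continuous f →
          IntervalIntegrable (fun y => ‖f y‖ ^ 2) volume (-1) 1 :=
        fun f hf => (hf.norm.pow 2).intervalIntegrable _ _
      have i0 := sq_int _ hf.continuous
      have i1 := sq_int _ c1.continuous
      have i2 := sq_int _ c2.continuous
      have i3 := sq_int _ c3.continuous
      rw [hw0, intervalIntegral.integral_add ((i3.add i2).add i1) i0,
        intervalIntegral.integral_add (i3.add i2) i1, intervalIntegral.integral_add i3 i2]
      rfl
    rw [hN] at hb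
    have hN0 := add_nonneg (add_nonneg (add_nonneg (hnn (deriv (deriv (deriv (ew k t w)))))
      (hnn (deriv (deriv (ew k t w))))) (hnn (deriv (ew k t w)))) (hnn w)
    have hs0 : 0 < |s| := by linarith
    refine sqrt_le_of_le (B := 1000 * (|s| ^ 2)⁻¹) (by positivity)
      (hb.trans ?_) ?_
    · refine mul_le_mul_of_nonneg_right ?_ hN0
      rw [sq_abs, mul_pow, ← inv_pow, ← pow_mul]
      gcongr
      norm_num
    · rw [← div_eq_mul_inv, ← div_eq_mul_inv, div_le_div_iff₀ (by positivity) (by positivity)]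
      nlinarith
end
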